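/- arXiv:1905.04713 — 2 statements merged into one kernel-verified Lean document; each statement's English description precedes it below -/
import Mathlib

section
/- Let n ≥ 2, let k be an integer with 1 ≤ k ≤ n, let β > 1/k and α ≤ 1 − kβ. Let u be a solution of the normalised flow ∂_t u = u^α σ_k^β − γu on S^n × [0,∞), where γ = C(n,k)^β. Then there exist positive constants C and C₀, depending only on α, β and u(·,0), such that max_{x∈S^n} |∇u(x,t)| / u(x,t) ≤ C e^{−C₀ t} for all t ≥ 0. -/
open MeasureTheory Filter
open scoped RealInnerProductSpace Topology

noncomputable section

/-- Euclidean ambient space `ℝ^{n+1}`. -/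
abbrev Eu (n : ℕ) : Type := EuclideanSpace ℝ (Fin (n + 1))

/-- The unit sphere `S^n ⊆ ℝ^{n+1}`. -/
def sph (n : ℕ) : Set (Eu n) := Metric.sphere (0 : Eu n) 1

/-- The 1-homogeneous extension `U(y) = |y|·u(y/|y|)` of a function on the sphere. -/
def homExt {n : ℕ} (u : Eu n → ℝ) (y : Eu n) : ℝ := ‖y‖ * u (‖y‖⁻¹ • y)

/-- The (Euclidean) Hessian of the 1-homogeneous extension, as an operator. -/
def hessOp {n : ℕ} (u : Eu n → ℝ) (x : Eu n) : Eu n →L[ℝ] Eu n :=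
  fderiv ℝ (gradient (homExt u)) x

/-- The `k`-th elementary symmetric function of the eigenvalues of an endomorphism of
`ℝ^{n+1}`, read off from the coefficients of the characteristic polynomial. -/
def esymmOp (n k : ℕ) (T : Eu n →ₗ[ℝ] Eu n) : ℝ :=
  (-1 : ℝ) ^ k * (LinearMap.charpoly T).coeff (n + 1 - k)

/-- `σ_k`, the `k`-th elementary symmetric function of the principal curvature radii,
i.e. of the eigenvalues of `W_u(x)`; since the Hessian of the 1-homogeneous extension
kills the radial direction, this agrees with the `k`-th elementary symmetric function of
all its eigenvalues. -/
def sigmaK (n k : ℕ) (u : Eu n → ℝ) (x : Eu n) : ℝ :=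
  esymmOp n k (hessOp u x).toLinearMap

/-- Smoothness on the sphere, expressed via the 1-homogeneous extension. -/
def SmoothOnSphere {n : ℕ} (u : Eu n → ℝ) : Prop :=
  ContDiffOn ℝ (⊤ : ℕ∞) (homExt u) {(0 : Eu n)}ᶜ

def PosOnSphere {n : ℕ} (u : Eu n → ℝ) : Prop := ∀ x ∈ sph n, 0 < u x

/-- Uniform convexity: `W_u(x)` is positive definite on the tangent hyperplane `x^⊥`. -/
def UnifConvex {n : ℕ} (u : Eu n → ℝ) : Prop :=
  ∀ x ∈ sph n, ∀ v : Eu n, ⟪x, v⟫ = 0 → v ≠ 0 → 0 < ⟪v, hessOp u x v⟫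

/-- `u` is the support function of a smooth, closed, uniformly convex hypersurface
enclosing the origin. -/
def GoodSph {n : ℕ} (u : Eu n → ℝ) : Prop :=
  SmoothOnSphere u ∧ PosOnSphere u ∧ UnifConvex u

/-- Integration over the sphere with respect to the surface (n-dimensional Hausdorff)
measure. -/
def sphInt (n : ℕ) (g : Eu n → ℝ) : ℝ :=
  ∫ x in sph n, g x ∂(Measure.hausdorffMeasure (n : ℝ))

/-- `|S^n|`. -/
def sphVol (n : ℕ) : ℝ := (Measure.hausdorffMeasure (n : ℝ) (sph n)).toReal

/-- The spherical gradient `∇u(x) = DU(x) − u(x)·x`. -/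
def sphGrad {n : ℕ} (u : Eu n → ℝ) (x : Eu n) : Eu n :=
  gradient (homExt u) x - u x • x

/-- The (unnormalised) anisotropic expanding flow `∂_t u = f u^α σ_k^β` on the time set `s`. -/
def ExpFlow (n k : ℕ) (α β : ℝ) (f : Eu n → ℝ) (s : Set ℝ) (u : ℝ → Eu n → ℝ) : Prop :=
  (∀ t ∈ s, GoodSph (u t)) ∧
  ∀ x ∈ sph n, ∀ t ∈ s,
    HasDerivWithinAt (fun r => u r x)
      (f x * u t x ^ α * sigmaK n k (u t) x ^ β) s t

/-- The global term `η(t) = |S^n|⁻¹ ∫ f u^α σ_k^{1+β}` of the normalised anisotropic flow. -/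
def eta (n k : ℕ) (α β : ℝ) (f v : Eu n → ℝ) : ℝ :=
  (sphVol n)⁻¹ * sphInt n (fun x => f x * v x ^ α * sigmaK n k v x ^ (1 + β))

/-- The normalised anisotropic flow `∂_t u = f u^α σ_k^β − η(t) u` on the time set `s`,
with the initial normalisation `∫ u σ_k = |S^n|`. -/
def NormFlow (n k : ℕ) (α β : ℝ) (f : Eu n → ℝ) (s : Set ℝ) (u : ℝ → Eu n → ℝ) : Prop :=
  (∀ t ∈ s, GoodSph (u t)) ∧
  sphInt n (fun x => u 0 x * sigmaK n k (u 0) x) = sphVol n ∧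
  ∀ x ∈ sph n, ∀ t ∈ s,
    HasDerivWithinAt (fun r => u r x)
      (f x * u t x ^ α * sigmaK n k (u t) x ^ β - eta n k α β f (u t) * u t x) s t

/-- The normalised isotropic (`f ≡ 1`) flow `∂_t u = u^α σ_k^β − γ u`, where
`γ = C(n,k)^β`. -/
def IsoNormFlow (n k : ℕ) (α β : ℝ) (s : Set ℝ) (u : ℝ → Eu n → ℝ) : Prop :=
  (∀ t ∈ s, GoodSph (u t)) ∧
  ∀ x ∈ sph n, ∀ t ∈ s,
    HasDerivWithinAt (fun r => u r x)
      (u t x ^ α * sigmaK n k (u t) x ^ β - (n.choose k : ℝ) ^ β * u t x) s t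

open Polynomial in
lemma aux_alt {ι : Type*} (s : Finset ι) (a : ι → ℝ) (ha : ∀ i, 0 ≤ a i) :
    ∀ j : ℕ, 0 ≤ (-1 : ℝ) ^ (s.card + j) * (∏ i ∈ s, (X - C (a i))).coeff j := by
  classical
  induction s using Finset.induction_on with
  | empty =>
    intro j
    rcases j with _ | j
    · simp
    · simp [Polynomial.coeff_one]
  | insert i s hi ih =>
    intro j
    rw [Finset.prod_insert hi, Finset.card_insert_of_notMem hi, sub_mul]
    rcases j with _ | j
    · have := mul_nonneg (ha i) (ih 0)
      simp only [coeff_sub, mul_coeff_zero, coeff_X_zero] at this ⊢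
      rw [coeff_C_zero]
      rw [pow_add, pow_add] at *
      simp only [pow_one, pow_zero] at *
      nlinarith
    · have h1 := mul_nonneg (ha i) (ih (j+1))
      have h2 := ih j
      simp only [coeff_sub, coeff_C_mul, coeff_X_mul] at h1 h2 ⊢
      rw [pow_add, pow_succ, pow_succ]
      rw [pow_add, pow_succ] at h1
      rw [pow_add] at h2
      nlinarith

open Polynomial in
lemma aux_rank1 {ι : Type*} [Fintype ι] [DecidableEq ι] (a w : ι → ℝ) :
    (Matrix.diagonal a + Matrix.vecMulVec w w).charpoly =
      ∏ i, (X - C (a i)) - ∑ i, C (w i ^ 2) * ∏ j ∈ Finset.univ.erase i, (X - C (a j)) := by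
  apply Polynomial.eq_of_infinite_eval_eq
  have : ((Set.range a)ᶜ).Infinite := (Set.finite_range a).infinite_compl
  refine this.mono fun r hr => ?_
  have hr' : ∀ i, r - a i ≠ 0 := fun i h => hr ⟨i, by linarith⟩
  simp only [Set.mem_ofPred_eq, Matrix.eval_charpoly]
  have e : Matrix.scalar ι r - (Matrix.diagonal a + Matrix.vecMulVec w w) =
      Matrix.diagonal (fun i => r - a i) + Matrix.replicateCol Unit (-w) * Matrix.replicateRow Unit w := by
    ext i j
    by_cases h : i = j
    · subst h; simp [Matrix.vecMulVec_apply, Matrix.mul_apply]; ring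
    · simp [Matrix.vecMulVec_apply, Matrix.mul_apply, h]
  have hdet : (Matrix.diagonal (fun i => r - a i)).det = ∏ i, (r - a i) := Matrix.det_diagonal
  have hu : IsUnit (Matrix.diagonal (fun i => r - a i)).det := by
    rw [hdet]; exact (Finset.prod_ne_zero_iff.2 fun i _ => hr' i).isUnit
  rw [e, Matrix.det_add_replicateCol_mul_replicateRow hu, hdet, Matrix.inv_diagonal]
  have hinv : Ring.inverse (fun i => r - a i) = fun i => (r - a i)⁻¹ := by
    have h1 : (fun i => r - a i) * (fun i => (r - a i)⁻¹) = 1 := by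
      funext i; simp [hr' i]
    have h2 : IsUnit (fun i => r - a i) := IsUnit.of_mul_eq_one _ h1
    have h3 := Ring.inverse_mul_cancel _ h2
    calc Ring.inverse (fun i => r - a i) = Ring.inverse (fun i => r - a i) * ((fun i => r - a i) * (fun i => (r - a i)⁻¹)) := by
          rw [h1, mul_one]
      _ = _ := by rw [← mul_assoc, h3, one_mul]
  rw [hinv]
  simp only [eval_sub, eval_prod, eval_X, eval_C, eval_finsetSum, eval_mul]
  have : (1 + Matrix.replicateRow Unit w * Matrix.diagonal (fun i => (r - a i)⁻¹) * Matrix.replicateCol Unit (-w)).det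
      = 1 - ∑ i, w i ^ 2 * (r - a i)⁻¹ := by
    rw [Matrix.det_unique]
    rw [Matrix.add_apply, Matrix.mul_apply, sub_eq_add_neg, ← Finset.sum_neg_distrib]
    simp only [Matrix.mul_diagonal, Matrix.replicateRow_apply, Matrix.replicateCol_apply,
      Matrix.one_apply_eq, Pi.neg_apply]
    congr 1
    exact Finset.sum_congr rfl fun i _ => by ring
  rw [this, mul_sub, mul_one, Finset.mul_sum]
  congr 1
  refine Finset.sum_congr rfl fun i _ => ?_
  rw [← Finset.mul_prod_erase Finset.univ _ (Finset.mem_univ i)]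
  field_simp [hr' i]

lemma aux_diag_mono {ι : Type*} [Fintype ι] [DecidableEq ι] (a w : ι → ℝ) (ha : ∀ i, 0 ≤ a i)
    (k j : ℕ) (hkj : k + j = Fintype.card ι) :
    (-1 : ℝ) ^ k * (Matrix.diagonal a).charpoly.coeff j ≤
    (-1 : ℝ) ^ k * (Matrix.diagonal a + Matrix.vecMulVec w w).charpoly.coeff j := by
  rw [aux_rank1, Matrix.charpoly_diagonal, Polynomial.coeff_sub, mul_sub, Polynomial.finsetSum_coeff,
    Finset.mul_sum, le_sub_self_iff]
  refine Finset.sum_nonpos fun i _ => ?_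
  rw [Polynomial.coeff_C_mul]
  have := aux_alt (Finset.univ.erase i) a ha j
  rw [Finset.card_erase_of_mem (Finset.mem_univ i), Finset.card_univ] at this
  have hc : 0 < Fintype.card ι := Fintype.card_pos_iff.2 ⟨i⟩
  have e : (-1 : ℝ) ^ (Fintype.card ι - 1 + j) = - (-1) ^ k := by
    have h2 : Fintype.card ι - 1 + j + 1 = k + 2 * j := by omega
    have : (-1 : ℝ) ^ (Fintype.card ι - 1 + j + 1) = (-1) ^ k := by
      rw [h2, pow_add, pow_mul]; simp
    rw [pow_succ] at this
    linarith
  rw [e] at this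
  nlinarith [mul_nonneg (sq_nonneg (w i)) this]

lemma aux_rank1_mono {ι : Type*} [Fintype ι] [DecidableEq ι] (A : Matrix ι ι ℝ) (hA : A.PosSemidef)
    (w : ι → ℝ) (k j : ℕ) (hkj : k + j = Fintype.card ι) :
    (-1 : ℝ) ^ k * A.charpoly.coeff j ≤ (-1 : ℝ) ^ k * (A + Matrix.vecMulVec w w).charpoly.coeff j := by
  set U : Matrix ι ι ℝ := (hA.isHermitian.eigenvectorUnitary : Matrix ι ι ℝ) with hU
  set d := hA.isHermitian.eigenvalues with hd
  have hs : A = U * Matrix.diagonal d * star U := by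
    have := hA.isHermitian.spectral_theorem
    rw [Unitary.conjStarAlgAut_apply] at this
    exact this
  have hUU : star U * U = 1 := Unitary.coe_star_mul_self _
  have hUU' : U * star U = 1 := Unitary.coe_mul_star_self _
  set w' := (star U).mulVec w with hw'
  have key : ∀ M : Matrix ι ι ℝ, (U * M * star U).charpoly = M.charpoly := by
    intro M
    rw [Matrix.charpoly_mul_comm, ← mul_assoc, hUU, one_mul]
  have h2 : A + Matrix.vecMulVec w w = U * (Matrix.diagonal d + Matrix.vecMulVec w' w') * star U := by
    rw [mul_add, add_mul, ← hs, Matrix.mul_vecMulVec, Matrix.vecMulVec_mul, hw', Matrix.mulVec_mulVec, hUU',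
      Matrix.one_mulVec]
    congr 2
    have : star U = U.transpose := rfl
    rw [this, ← Matrix.mulVec_transpose, Matrix.transpose_transpose, Matrix.mulVec_mulVec, ← this, hUU', Matrix.one_mulVec]
  rw [h2, key, hs, key]
  exact aux_diag_mono d w' (fun i => hA.eigenvalues_nonneg i) k j hkj

open scoped MatrixOrder Matrix.Norms.L2Operator in
lemma aux_psd_fac {ι : Type*} [Fintype ι] [DecidableEq ι] (B : Matrix ι ι ℝ) (hB : B.PosSemidef) :
    ∃ M : Matrix ι ι ℝ, B = M.conjTranspose * M :=
  CStarAlgebra.nonneg_iff_eq_star_mul_self.mp hB.nonneg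

lemma aux_psd_mono {ι : Type*} [Fintype ι] [DecidableEq ι] (A B : Matrix ι ι ℝ) (hA : A.PosSemidef)
    (hB : (B - A).PosSemidef) (k j : ℕ) (hkj : k + j = Fintype.card ι) :
    (-1 : ℝ) ^ k * A.charpoly.coeff j ≤ (-1 : ℝ) ^ k * B.charpoly.coeff j := by
  obtain ⟨M, hM⟩ := aux_psd_fac _ hB
  have hsum : B = A + ∑ i, Matrix.vecMulVec (M i) (M i) := by
    have : B = A + (B - A) := by abel
    rw [this, hM]
    congr 1
    ext p q
    simp [Matrix.mul_apply, Matrix.sum_apply, Matrix.vecMulVec_apply]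
  rw [hsum]
  have : ∀ s : Finset ι, (A + ∑ i ∈ s, Matrix.vecMulVec (M i) (M i)).PosSemidef ∧
      (-1 : ℝ) ^ k * A.charpoly.coeff j ≤
        (-1 : ℝ) ^ k * (A + ∑ i ∈ s, Matrix.vecMulVec (M i) (M i)).charpoly.coeff j := by
    intro s
    induction s using Finset.induction_on with
    | empty => simp [hA]
    | insert i s hi ih =>
      have e : A + ∑ i ∈ insert i s, Matrix.vecMulVec (M i) (M i) =
        (A + ∑ i ∈ s, Matrix.vecMulVec (M i) (M i)) + Matrix.vecMulVec (M i) (M i) := by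
        rw [Finset.sum_insert hi]; abel
      rw [e]
      refine ⟨ih.1.add ?_, ih.2.trans (aux_rank1_mono _ ih.1 _ k j hkj)⟩
      simpa using Matrix.posSemidef_vecMulVec_self_star (M i)
  exact (this Finset.univ).2

open Polynomial in
lemma aux_smul {ι : Type*} [Fintype ι] [DecidableEq ι] (A : Matrix ι ι ℝ) (R : ℝ)
    (k j : ℕ) (hkj : k + j = Fintype.card ι) :
    (R • A).charpoly.coeff j = R ^ k * A.charpoly.coeff j := by
  by_cases hR : R = 0
  · subst hR
    rw [zero_smul, Matrix.charpoly_zero]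
    rcases k with _ | k
    · have : j = Fintype.card ι := by omega
      rw [this]
      have := A.charpoly_monic
      rw [Monic, leadingCoeff, A.charpoly_natDegree_eq_dim] at this
      simp [this]
    · rw [coeff_X_pow, if_neg (by omega)]; simp
  have : (R • A).charpoly = C (R ^ Fintype.card ι) * A.charpoly.comp (C R⁻¹ * X) := by
    apply Polynomial.funext
    intro r
    rw [Matrix.eval_charpoly, eval_mul, eval_comp, Matrix.eval_charpoly]
    simp only [eval_C, eval_mul, eval_X]
    rw [← Matrix.det_smul]
    congr 1
    rw [smul_sub]
    congr 1
    ext a b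
    by_cases h : a = b
    · subst h; simp; field_simp
    · simp [h]
  rw [this, coeff_C_mul, comp_C_mul_X_coeff, ← hkj, pow_add, inv_pow]
  field_simp


lemma esymm_mono {n k : ℕ} (hkn : k ≤ n) (S T : Eu n →ₗ[ℝ] Eu n) (hS : S.IsSymmetric) (hT : T.IsSymmetric)
    (h0 : ∀ v, 0 ≤ ⟪v, S v⟫) (h1 : ∀ v, ⟪v, S v⟫ ≤ ⟪v, T v⟫) : esymmOp n k S ≤ esymmOp n k T := by
  unfold esymmOp
  let b := EuclideanSpace.basisFun (Fin (n + 1)) ℝ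
  rw [← LinearMap.charpoly_toMatrix S b.toBasis, ← LinearMap.charpoly_toMatrix T b.toBasis]
  apply aux_psd_mono
  · rw [LinearMap.posSemidef_toMatrix_iff]
    refine ⟨hS, fun v => ?_⟩
    rw [real_inner_comm]; simpa using h0 v
  · rw [← map_sub, LinearMap.posSemidef_toMatrix_iff]
    refine ⟨hT.sub hS, fun v => ?_⟩
    rw [real_inner_comm]
    simpa [inner_sub_right] using h1 v
  · simp; omega

lemma esymm_smul {n k : ℕ} (hkn : k ≤ n) (T : Eu n →ₗ[ℝ] Eu n) (R : ℝ) :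
    esymmOp n k (R • T) = R ^ k * esymmOp n k T := by
  unfold esymmOp
  let b := EuclideanSpace.basisFun (Fin (n + 1)) ℝ
  rw [← LinearMap.charpoly_toMatrix (R • T) b.toBasis, ← LinearMap.charpoly_toMatrix T b.toBasis,
    map_smul, aux_smul _ R k (n + 1 - k) (by simp; omega)]
  ring

lemma esymm_nonneg {n k : ℕ} (hk : 1 ≤ k) (hkn : k ≤ n) (S : Eu n →ₗ[ℝ] Eu n) (hS : S.IsSymmetric)
    (h0 : ∀ v, 0 ≤ ⟪v, S v⟫) : 0 ≤ esymmOp n k S := by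
  have := esymm_mono hkn 0 S LinearMap.IsSymmetric.zero hS (by simp) (by simpa using h0)
  refine le_trans (le_of_eq ?_) this
  have h := esymm_smul hkn (0 : Eu n →ₗ[ℝ] Eu n) 0
  rw [smul_zero, zero_pow (by omega), zero_mul] at h
  exact h.symm

lemma esymm_conj {n k : ℕ} (S : Eu n →ₗ[ℝ] Eu n) (ρ : Eu n ≃ₗ[ℝ] Eu n) :
    esymmOp n k (ρ.conj S) = esymmOp n k S := by
  unfold esymmOp
  rw [LinearEquiv.charpoly_conj]

open Polynomial in
lemma esymm_proj {n k : ℕ} (hk : 1 ≤ k) (hkn : k ≤ n) (x : Eu n) (hx : ‖x‖ = 1) (c : ℝ)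
    (T : Eu n →ₗ[ℝ] Eu n) (hT : ∀ v, T v = c • (v - ⟪x, v⟫ • x)) :
    esymmOp n k T = c ^ k * (n.choose k : ℝ) := by
  unfold esymmOp
  let b := EuclideanSpace.basisFun (Fin (n + 1)) ℝ
  rw [← LinearMap.charpoly_toMatrix T b.toBasis]
  have e : LinearMap.toMatrix b.toBasis b.toBasis T =
      (-c) • (Matrix.diagonal (fun _ => (-1 : ℝ)) + Matrix.vecMulVec (fun i => x i) (fun i => x i)) := by
    ext i j
    rw [LinearMap.toMatrix_apply, hT]
    by_cases h : i = j
    · subst h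
      simp [b, Matrix.vecMulVec_apply, EuclideanSpace.inner_single_right]
      ring
    · simp only [b, Matrix.vecMulVec_apply]
      simp [EuclideanSpace.inner_single_right, h]
      exact Or.inl (mul_comm _ _)
  rw [e, aux_smul _ _ k (n + 1 - k) (by simp; omega), aux_rank1]
  have hs : ∑ i, x i ^ 2 = 1 := by
    have := EuclideanSpace.real_norm_sq_eq x
    rw [← this, hx]; norm_num
  have : (∏ i : Fin (n + 1), (X - C (-1 : ℝ)) - ∑ i, C (x i ^ 2) * ∏ j ∈ Finset.univ.erase i, (X - C (-1 : ℝ)))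
      = X * (X + 1) ^ n := by
    have h1 : ∀ i : Fin (n+1), C (x i ^ 2) * ∏ j ∈ Finset.univ.erase i, (X - C (-1 : ℝ)) = C (x i ^ 2) * (X + 1) ^ n := by
      intro i
      rw [Finset.prod_const, Finset.card_erase_of_mem (Finset.mem_univ i)]
      simp
    rw [Finset.sum_congr rfl fun i _ => h1 i, ← Finset.sum_mul, ← map_sum, hs]
    simp [pow_succ]
    ring
  rw [this]
  have hk' : n + 1 - k = (n - k) + 1 := by omega
  rw [hk', coeff_X_mul, coeff_X_add_one_pow, Nat.choose_symm hkn, ← mul_assoc, ← mul_pow]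
  simp


lemma snd_test (q q' : ℝ → ℝ) (q'' : ℝ) (h1 : ∀ᶠ s in 𝓝 (0 : ℝ), HasDerivAt q (q' s) s)
    (h2 : HasDerivAt q' q'' 0) (hm : IsLocalMax q 0) : q'' ≤ 0 := by
  by_contra hc
  push Not at hc
  have hd : deriv q =ᶠ[𝓝 0] q' := h1.mono fun s hs => hs.deriv
  have hdd : deriv (deriv q) 0 = q'' := by rw [hd.deriv_eq, h2.deriv]
  have hcont : ContinuousAt q 0 := h1.self_of_nhds.continuousAt
  have hmin := isLocalMin_of_deriv_deriv_pos (f := q) (x₀ := 0) (by rw [hdd]; exact hc) hm.deriv_eq_zero hcont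
  have hconst : q =ᶠ[𝓝 0] fun _ => q 0 := by
    filter_upwards [hm, hmin] with s a b using le_antisymm a b
  have hz : deriv q =ᶠ[𝓝 0] fun _ => 0 := by
    have := hconst.deriv
    simpa using this
  have : deriv (deriv q) 0 = 0 := by rw [hz.deriv_eq]; simp
  linarith

section calcu
variable {n : ℕ} {u : Eu n → ℝ}

lemma homExt_zero : homExt u 0 = 0 := by simp [homExt]

lemma homExt_smul (c : ℝ) (hc : 0 ≤ c) (y : Eu n) : homExt u (c • y) = c * homExt u y := by
  rcases hc.eq_or_lt with rfl | hc
  · simp [homExt]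
  · unfold homExt
    rw [norm_smul, Real.norm_of_nonneg hc.le, smul_smul, mul_inv, mul_assoc]
    congr 4
    field_simp

lemma homExt_sph (x : Eu n) (hx : ‖x‖ = 1) : homExt u x = u x := by
  simp [homExt, hx]

lemma cdAt (hs : SmoothOnSphere u) {y : Eu n} (hy : y ≠ 0) : ContDiffAt ℝ (⊤ : ℕ∞) (homExt u) y :=
  hs.contDiffAt (isOpen_compl_singleton.mem_nhds hy)

lemma hasFD (hs : SmoothOnSphere u) {y : Eu n} (hy : y ≠ 0) :
    HasFDerivAt (homExt u) (fderiv ℝ (homExt u) y) y :=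
  ((cdAt hs hy).differentiableAt (by simp)).hasFDerivAt

lemma inner_grad (y v : Eu n) : ⟪gradient (homExt u) y, v⟫ = fderiv ℝ (homExt u) y v := by
  rw [← toDual_gradient]; simp

lemma fderiv_diff (hs : SmoothOnSphere u) {y : Eu n} (hy : y ≠ 0) :
    DifferentiableAt ℝ (fderiv ℝ (homExt u)) y := by
  have : ContDiffAt ℝ 1 (fderiv ℝ (homExt u)) y :=
    (cdAt hs hy).fderiv_right (m := 1) (by norm_cast)
  exact this.differentiableAt (by simp)

lemma hasFD_grad (hs : SmoothOnSphere u) {y : Eu n} (hy : y ≠ 0) :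
    HasFDerivAt (gradient (homExt u)) (hessOp u y) y := by
  have h : DifferentiableAt ℝ (gradient (homExt u)) y := by
    have := (InnerProductSpace.toDual ℝ (Eu n)).symm.differentiable.differentiableAt.comp y (fderiv_diff hs hy)
    exact this
  exact h.hasFDerivAt

lemma inner_hess (hs : SmoothOnSphere u) {y : Eu n} (hy : y ≠ 0) (v w : Eu n) :
    ⟪hessOp u y v, w⟫ = fderiv ℝ (fderiv ℝ (homExt u)) y v w := by
  have h1 : HasFDerivAt (fun z => ⟪gradient (homExt u) z, w⟫) ((innerSL ℝ).flip w ∘L hessOp u y) y :=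
    ((innerSL ℝ).flip w).hasFDerivAt.comp y (hasFD_grad hs hy)
  have h2 : HasFDerivAt (fun z => ⟪gradient (homExt u) z, w⟫)
      ((ContinuousLinearMap.apply ℝ ℝ w) ∘L (fderiv ℝ (fderiv ℝ (homExt u)) y)) y := by
    simp only [inner_grad]
    exact (ContinuousLinearMap.apply ℝ ℝ w).hasFDerivAt.comp y (fderiv_diff hs hy).hasFDerivAt
  exact congrArg (fun L => L v) (h1.unique h2)

lemma hess_symm (hs : SmoothOnSphere u) {y : Eu n} (hy : y ≠ 0) :
    (hessOp u y).toLinearMap.IsSymmetric := by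
  intro v w
  have h := (cdAt hs hy).isSymmSndFDerivAt (by rw [minSmoothness_of_isRCLikeNormedField]; exact WithTop.coe_le_coe.2 (le_top : (2:ℕ∞) ≤ ⊤))
  have := h v w
  change ⟪hessOp u y v, w⟫ = ⟪v, hessOp u y w⟫
  rw [real_inner_comm (hessOp u y w) v, inner_hess hs hy, inner_hess hs hy, this]

lemma line_deriv1 (hs : SmoothOnSphere u) (x v : Eu n) (s : ℝ) (h : x + s • v ≠ 0) :
    HasDerivAt (fun r : ℝ => homExt u (x + r • v)) ⟪gradient (homExt u) (x + s • v), v⟫ s := by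
  rw [inner_grad]
  have hl : HasDerivAt (fun r : ℝ => x + r • v) v s := by
    simpa using ((hasDerivAt_id s).smul_const v).const_add x
  exact (hasFD hs h).comp_hasDerivAt s hl

lemma line_deriv2 (hs : SmoothOnSphere u) (x v w : Eu n) (s : ℝ) (h : x + s • v ≠ 0) :
    HasDerivAt (fun r : ℝ => ⟪gradient (homExt u) (x + r • v), w⟫) ⟪hessOp u (x + s • v) v, w⟫ s := by
  have hl : HasDerivAt (fun r : ℝ => x + r • v) v s := by
    simpa using ((hasDerivAt_id s).smul_const v).const_add x
  have := (hasFD_grad hs h).comp_hasDerivAt s hl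
  have h3 := this.inner ℝ (hasDerivAt_const s w)
  simpa using h3

lemma grad_hom (hs : SmoothOnSphere u) {y : Eu n} (hy : y ≠ 0) (c : ℝ) (hc : 0 < c) :
    gradient (homExt u) (c • y) = gradient (homExt u) y := by
  apply ext_inner_right ℝ
  intro v
  have hcy : c • y ≠ 0 := smul_ne_zero hc.ne' hy
  have h1 := line_deriv1 hs (c • y) (c • v) 0 (by simpa using hcy)
  have h2 := (line_deriv1 hs y v 0 (by simpa using hy)).const_mul c
  have e : (fun r : ℝ => homExt u (c • y + r • c • v)) = fun r => c * homExt u (y + r • v) := by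
    funext r
    rw [← homExt_smul c hc.le, smul_add, smul_comm c r v]
  rw [e] at h1
  have := h1.unique h2
  simp only [zero_smul, add_zero, inner_smul_right] at this
  exact mul_left_cancel₀ hc.ne' this

lemma euler (hs : SmoothOnSphere u) {y : Eu n} (hy : y ≠ 0) :
    ⟪gradient (homExt u) y, y⟫ = homExt u y := by
  have h1 := line_deriv1 hs y y 0 (by simpa using hy)
  have h2 : HasDerivAt (fun r : ℝ => (1 + r) * homExt u y) (homExt u y) 0 := by
    simpa using ((hasDerivAt_id (0:ℝ)).const_add 1).mul_const (homExt u y)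
  have e : (fun r : ℝ => homExt u (y + r • y)) =ᶠ[𝓝 0] fun r => (1 + r) * homExt u y := by
    filter_upwards [Ioi_mem_nhds (show (-1 : ℝ) < 0 by norm_num)] with r hr
    have hr : -1 < r := hr
    rw [← homExt_smul (1 + r) (by linarith), add_smul, one_smul]
  have := h1.unique (h2.congr_of_eventuallyEq e)
  simpa using this

lemma hess_self (hs : SmoothOnSphere u) {y : Eu n} (hy : y ≠ 0) : hessOp u y y = 0 := by
  apply ext_inner_right ℝ
  intro w
  have h1 := line_deriv2 hs y y w 0 (by simpa using hy)
  have e : (fun r : ℝ => ⟪gradient (homExt u) (y + r • y), w⟫) =ᶠ[𝓝 0] fun r => ⟪gradient (homExt u) y, w⟫ := by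
    filter_upwards [Ioi_mem_nhds (show (-1 : ℝ) < 0 by norm_num)] with r hr
    have hr : -1 < r := hr
    rw [← grad_hom hs hy (1 + r) (by linarith), add_smul, one_smul]
  have := h1.unique ((hasDerivAt_const (0:ℝ) _).congr_of_eventuallyEq e)
  simpa using this

lemma hess_hom (hs : SmoothOnSphere u) {y : Eu n} (hy : y ≠ 0) (c : ℝ) (hc : 0 < c) (v w : Eu n) :
    c * ⟪hessOp u (c • y) v, w⟫ = ⟪hessOp u y v, w⟫ := by
  have hcy : c • y ≠ 0 := smul_ne_zero hc.ne' hy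
  have h1 := line_deriv2 hs (c • y) (c • v) w 0 (by simpa using hcy)
  have h2 := line_deriv2 hs y v w 0 (by simpa using hy)
  have e : (fun r : ℝ => ⟪gradient (homExt u) (c • y + r • c • v), w⟫) =ᶠ[𝓝 0]
      fun r : ℝ => ⟪gradient (homExt u) (y + r • v), w⟫ := by
    have hc' : ContinuousAt (fun r : ℝ => y + r • v) 0 := by fun_prop
    have : ∀ᶠ r : ℝ in 𝓝 0, y + r • v ≠ 0 := hc'.eventually_ne (by simpa using hy)
    filter_upwards [this] with r hr
    rw [← grad_hom hs hr c hc, smul_add, smul_comm c r v]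
  have := (h1.congr_of_eventuallyEq e.symm).unique h2
  simpa [inner_smul_left] using this

lemma hess_decomp (hs : SmoothOnSphere u) {x : Eu n} (hx : ‖x‖ = 1) (v : Eu n) :
    ⟪v, hessOp u x v⟫ = ⟪v - ⟪x, v⟫ • x, hessOp u x (v - ⟪x, v⟫ • x)⟫ := by
  have hx0 : x ≠ 0 := by rintro rfl; simp at hx
  have h1 : ⟪x, hessOp u x v⟫ = 0 := by
    have := hess_symm hs hx0 x v
    change ⟪hessOp u x x, v⟫ = ⟪x, hessOp u x v⟫ at this
    rw [← this, hess_self hs hx0]; simp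
  rw [map_sub, map_smul, hess_self hs hx0, smul_zero, sub_zero, inner_sub_left, inner_smul_left, h1]
  simp

lemma orth_comp {x : Eu n} (hx : ‖x‖ = 1) (v : Eu n) : ⟪x, v - ⟪x, v⟫ • x⟫ = 0 := by
  rw [inner_sub_right, inner_smul_right, real_inner_self_eq_norm_sq, hx]; ring

lemma hess_psd1 (hg : GoodSph u) {x : Eu n} (hx : ‖x‖ = 1) (v : Eu n) : 0 ≤ ⟪v, hessOp u x v⟫ := by
  rw [hess_decomp hg.1 hx]
  by_cases h : v - ⟪x, v⟫ • x = 0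
  · rw [h]; simp
  · exact (hg.2.2 x (by simp [sph, hx]) _ (orth_comp hx v) h).le

lemma hess_psd (hg : GoodSph u) {y : Eu n} (hy : y ≠ 0) (v : Eu n) : 0 ≤ ⟪hessOp u y v, v⟫ := by
  have hn : 0 < ‖y‖ := norm_pos_iff.2 hy
  have h := hess_hom hg.1 hy ‖y‖⁻¹ (inv_pos.2 hn) v v
  rw [← h]
  refine mul_nonneg (inv_pos.2 hn).le ?_
  rw [real_inner_comm]
  exact hess_psd1 hg (by rw [norm_smul, norm_inv, norm_norm]; field_simp) v

lemma homExt_nonneg (hg : GoodSph u) (y : Eu n) : 0 ≤ homExt u y := by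
  by_cases hy : y = 0
  · subst hy; rw [homExt_zero]
  · have hn : 0 < ‖y‖ := norm_pos_iff.2 hy
    refine mul_nonneg hn.le (hg.2.1 _ ?_).le
    simp [sph, norm_smul, hn.ne']

lemma homExt_sub_aux (hg : GoodSph u) (x : Eu n) (c : ℝ) (hc : 0 ≤ c) :
    homExt u (x + (-c) • x) ≤ homExt u x + homExt u ((-c) • x) := by
  by_cases h1 : c ≤ 1
  · have : x + (-c) • x = (1 - c) • x := by rw [sub_smul, one_smul, neg_smul]; abel
    rw [this, homExt_smul _ (by linarith)]
    nlinarith [homExt_nonneg hg x, homExt_nonneg hg ((-c) • x)]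
  · push Not at h1
    have : x + (-c) • x = (1 - c⁻¹) • ((-c) • x) := by
      rw [smul_smul]
      have : (1 - c⁻¹) * (-c) = 1 + - c := by field_simp; ring
      rw [this, add_smul, one_smul]
    have h3 : 0 < c⁻¹ := by positivity
    have h4 : c⁻¹ < 1 := inv_lt_one_of_one_lt₀ h1
    rw [this, homExt_smul _ (by linarith)]
    nlinarith [homExt_nonneg hg x, homExt_nonneg hg ((-c) • x)]

lemma homExt_subadd (hg : GoodSph u) (x y : Eu n) : homExt u (x + y) ≤ homExt u x + homExt u y := by
  by_cases h : ∀ s ∈ Set.Icc (0:ℝ) 1, x + s • (y - x) ≠ 0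
  · have hconv : ConvexOn ℝ (Set.Icc (0:ℝ) 1) (fun s : ℝ => homExt u (x + s • (y - x))) := by
      refine convexOn_of_hasDerivWithinAt2_nonneg (f' := fun s : ℝ => ⟪gradient (homExt u) (x + s • (y - x)), y - x⟫)
        (f'' := fun s : ℝ => ⟪hessOp u (x + s • (y - x)) (y - x), y - x⟫) (convex_Icc 0 1) ?_ ?_ ?_ ?_
      · intro s hs
        exact (line_deriv1 hg.1 x (y - x) s (h s hs)).continuousAt.continuousWithinAt
      · intro s hs
        exact (line_deriv1 hg.1 x (y - x) s (h s (interior_subset hs))).hasDerivWithinAt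
      · intro s hs
        exact (line_deriv2 hg.1 x (y - x) _ s (h s (interior_subset hs))).hasDerivWithinAt
      · intro s hs
        exact hess_psd hg (h s (interior_subset hs)) _
    have := hconv.2 (show (0:ℝ) ∈ Set.Icc (0:ℝ) 1 by simp) (show (1:ℝ) ∈ Set.Icc (0:ℝ) 1 by simp)
      (show (0:ℝ) ≤ 1/2 by norm_num) (show (0:ℝ) ≤ 1/2 by norm_num) (by norm_num)
    simp only [smul_eq_mul, mul_zero, mul_one, zero_add, zero_smul, add_zero, one_smul, add_sub_cancel] at this
    have e : x + (1 / 2 : ℝ) • (y - x) = (1 / 2 : ℝ) • (x + y) := by module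
    rw [e, homExt_smul _ (by norm_num)] at this
    linarith
  · push Not at h
    obtain ⟨s, ⟨h0, h1⟩, hs⟩ := h
    rcases h0.eq_or_lt with rfl | h0
    · have : x = 0 := by simpa using hs
      subst this; simp [homExt_zero]
    · have : y = (-((1 - s) / s)) • x := by
        have h2 : s • y = (-(1 - s)) • x := by
          have : s • y = (x + s • (y - x)) + (-(1 - s)) • x := by module
          rw [this, hs, zero_add]
        have h3 : y = s⁻¹ • (s • y) := by rw [smul_smul, inv_mul_cancel₀ h0.ne', one_smul]
        rw [h3, h2, smul_smul]
        congr 1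
        field_simp
      rw [this]
      exact homExt_sub_aux hg x _ (div_nonneg (by linarith) h0.le)

end calcu


lemma left_deriv_nonneg (f : ℝ → ℝ) (f' t₀ : ℝ) (hf : HasDerivAt f f' t₀) (h0 : 0 < t₀)
    (h : ∀ t ∈ Set.Icc 0 t₀, f t ≤ f t₀) : 0 ≤ f' := by
  have h1 : Tendsto (slope f t₀) (𝓝[<] t₀) (𝓝 f') :=
    (hasDerivAt_iff_tendsto_slope.1 hf).mono_left (nhdsWithin_mono _ (fun x hx => ne_of_lt hx))
  refine ge_of_tendsto h1 ?_
  filter_upwards [Ioo_mem_nhdsLT h0] with t ht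
  rw [slope_def_field]
  exact div_nonneg_of_nonpos (by linarith [h t ⟨ht.1.le, ht.2.le⟩]) (by linarith [ht.2])

lemma hess_min {n : ℕ} {u : Eu n → ℝ} (hs : SmoothOnSphere u) {x : Eu n} (hx : ‖x‖ = 1) (a : ℝ) (ha : 0 ≤ a)
    (h : ∀ y, a * ‖y‖ ≤ homExt u y) (hxa : homExt u x = a) (v : Eu n) :
    a * (‖v‖ ^ 2 - ⟪x, v⟫ ^ 2) ≤ ⟪v, hessOp u x v⟫ := by
  have hx0 : x ≠ 0 := by rintro rfl; simp at hx
  have key : ∀ w : Eu n, ⟪x, w⟫ = 0 → a * ‖w‖ ^ 2 ≤ ⟪w, hessOp u x w⟫ := by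
    intro w hw
    set N := ‖w‖ ^ 2 with hN
    have hr : ∀ s : ℝ, ‖x + s • w‖ ^ 2 = 1 + s ^ 2 * N := by
      intro s
      rw [norm_add_sq_real, hx, inner_smul_right, hw, norm_smul, mul_pow, Real.norm_eq_abs, sq_abs]
      ring
    have hne : ∀ s : ℝ, x + s • w ≠ 0 := by
      intro s h0
      have := hr s
      rw [h0] at this
      simp at this
      nlinarith [sq_nonneg s, sq_nonneg ‖w‖, mul_nonneg (sq_nonneg s) (sq_nonneg ‖w‖)]
    have := snd_test (fun s => a * (1 + s ^ 2 * (N / 2) - s ^ 4 * (N ^ 2 / 2)) - homExt u (x + s • w))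
      (fun s => a * (2 * s * (N / 2) - 4 * s ^ 3 * (N ^ 2 / 2)) - ⟪gradient (homExt u) (x + s • w), w⟫)
      (a * N - ⟪hessOp u (x + (0:ℝ) • w) w, w⟫) ?_ ?_ ?_
    · rw [zero_smul, add_zero, real_inner_comm] at this
      linarith
    · refine Eventually.of_forall fun s => ?_
      refine HasDerivAt.sub ?_ (line_deriv1 hs x w s (hne s))
      refine HasDerivAt.const_mul a ?_
      have h1 := ((hasDerivAt_pow 2 s).mul_const (N / 2)).const_add 1
      have h2 := (hasDerivAt_pow 4 s).mul_const (N ^ 2 / 2)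
      refine (h1.sub h2).congr_deriv ?_
      norm_num
    · refine HasDerivAt.sub ?_ (line_deriv2 hs x w w 0 (hne 0))
      refine HasDerivAt.const_mul a ?_
      have h1 := ((hasDerivAt_id (0:ℝ)).const_mul 2).mul_const (N / 2)
      have h2 := ((hasDerivAt_pow 3 (0:ℝ)).const_mul 4).mul_const (N ^ 2 / 2)
      refine (h1.sub h2).congr_deriv ?_
      norm_num
      ring
    · refine Eventually.of_forall fun s => ?_
      have e0 : a * (1 + (0:ℝ) ^ 2 * (N / 2) - (0:ℝ) ^ 4 * (N ^ 2 / 2)) - homExt u (x + (0:ℝ) • w) = 0 := by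
        rw [zero_smul, add_zero, hxa]; ring
      simp only
      rw [e0]
      set r := ‖x + s • w‖ with hrr
      have h3 := h (x + s • w)
      rw [← hrr] at h3
      have hr0 : 0 ≤ r := norm_nonneg _
      have h4 : 1 + s ^ 2 * (N / 2) - s ^ 4 * (N ^ 2 / 2) = (3 * r ^ 2 - (r ^ 2) ^ 2) / 2 := by
        rw [hr s]; ring
      have h5 : (3 * r ^ 2 - (r ^ 2) ^ 2) / 2 ≤ r := by
        nlinarith [mul_nonneg (mul_nonneg hr0 (sq_nonneg (r - 1))) (show 0 ≤ r + 2 by linarith)]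
      rw [h4]
      nlinarith [mul_le_mul_of_nonneg_left h5 ha]
  rw [hess_decomp hs hx]
  refine le_trans (le_of_eq ?_) (key _ (orth_comp hx v))
  rw [norm_sub_sq_real, inner_smul_right, norm_smul, hx, real_inner_comm x v, mul_one, Real.norm_eq_abs, sq_abs]
  ring

lemma hess_cmp {n : ℕ} {u : Eu n → ℝ} (hs : SmoothOnSphere u) {x ν : Eu n} (hx0 : x ≠ 0) (hxν : 0 < ⟪x, ν⟫)
    (R c : ℝ) (ρ : Eu n ≃ₗᵢ[ℝ] Eu n)
    (h : ∀ y, 0 < ⟪y, ν⟫ → homExt u y ≤ R * (homExt u (ρ y) + c * ⟪y, ν⟫))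
    (hx : homExt u x = R * (homExt u (ρ x) + c * ⟪x, ν⟫)) (v : Eu n) :
    ⟪v, hessOp u x v⟫ ≤ R * ⟪ρ v, hessOp u (ρ x) (ρ v)⟫ := by
  have hρx : ρ x ≠ 0 := by simpa using hx0
  have c1 : ContinuousAt (fun s : ℝ => x + s • v) 0 := by fun_prop
  have c2 : ContinuousAt (fun s : ℝ => ρ x + s • ρ v) 0 := by fun_prop
  have c3 : ContinuousAt (fun s : ℝ => ⟪x + s • v, ν⟫) 0 := by fun_prop
  have n1 : ∀ᶠ s : ℝ in 𝓝 0, x + s • v ≠ 0 := c1.eventually_ne (by simpa using hx0)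
  have n2 : ∀ᶠ s : ℝ in 𝓝 0, ρ x + s • ρ v ≠ 0 := c2.eventually_ne (by simpa using hρx)
  have n3 : ∀ᶠ s : ℝ in 𝓝 0, 0 < ⟪x + s • v, ν⟫ := c3.eventually (lt_mem_nhds (by simpa using hxν))
  have := snd_test
    (fun s => homExt u (x + s • v) - R * (homExt u (ρ x + s • ρ v) + c * ⟪x + s • v, ν⟫))
    (fun s => ⟪gradient (homExt u) (x + s • v), v⟫ -
      R * (⟪gradient (homExt u) (ρ x + s • ρ v), ρ v⟫ + c * ⟪v, ν⟫))
    (⟪hessOp u (x + (0:ℝ) • v) v, v⟫ - R * (⟪hessOp u (ρ x + (0:ℝ) • ρ v) (ρ v), ρ v⟫)) ?_ ?_ ?_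
  · simp only [zero_smul, add_zero] at this
    rw [real_inner_comm, real_inner_comm (ρ v)] at this
    linarith
  · filter_upwards [n1, n2] with s h1 h2
    refine (line_deriv1 hs x v s h1).sub (((line_deriv1 hs (ρ x) (ρ v) s h2).add (HasDerivAt.const_mul c ?_)).const_mul R)
    have : (fun s : ℝ => ⟪x + s • v, ν⟫) = fun s => ⟪x, ν⟫ + s * ⟪v, ν⟫ := by
      funext s; rw [inner_add_left, inner_smul_left]; simp
    rw [this]
    simpa using ((hasDerivAt_id s).mul_const ⟪v, ν⟫).const_add ⟪x, ν⟫
  · have h1 := line_deriv2 hs x v v 0 (by simpa using hx0)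
    have h2 := line_deriv2 hs (ρ x) (ρ v) (ρ v) 0 (by simpa using hρx)
    exact h1.sub ((h2.add_const _).const_mul R)
  · filter_upwards [n3] with s h3
    have := h _ h3
    rw [map_add, map_smul] at this
    simp only [zero_smul, add_zero]
    rw [← hx]
    linarith

section flow
variable {n : ℕ} {u : ℝ → Eu n → ℝ}

lemma sph_iff {x : Eu n} : x ∈ sph n ↔ ‖x‖ = 1 := by simp [sph]

lemma homExt_cont (hc : ∀ x ∈ sph n, ContinuousOn (fun r => u r x) (Set.Ici 0)) (y : Eu n) :
    ContinuousOn (fun r => homExt (u r) y) (Set.Ici 0) := by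
  by_cases hy : y = 0
  · subst hy; simp only [homExt_zero]; exact continuousOn_const
  · unfold homExt
    refine continuousOn_const.mul (hc _ ?_)
    simp [sph_iff, norm_smul, norm_ne_zero_iff.2 hy]

lemma unif_bound (hg : ∀ t ∈ Set.Ici (0:ℝ), GoodSph (u t))
    (hc : ∀ x ∈ sph n, ContinuousOn (fun r => u r x) (Set.Ici 0)) (T : ℝ) :
    ∃ M : ℝ, 0 < M ∧ ∀ t ∈ Set.Icc 0 T, ∀ y, homExt (u t) y ≤ M * ‖y‖ := by
  have hb : ∀ y : Eu n, ∃ B : ℝ, 0 ≤ B ∧ ∀ t ∈ Set.Icc 0 T, homExt (u t) y ≤ B := by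
    intro y
    obtain ⟨B, hB⟩ := (isCompact_Icc (a := (0:ℝ)) (b := T)).bddAbove_image
      ((homExt_cont hc y).mono Set.Icc_subset_Ici_self)
    exact ⟨max B 0, le_max_right _ _, fun t ht => (hB ⟨t, ht, rfl⟩).trans (le_max_left _ _)⟩
  choose B hB0 hB using hb
  let e : Fin (n + 1) → Eu n := fun i => EuclideanSpace.single i (1:ℝ)
  refine ⟨∑ i, (B (e i) + B (-e i)) + 1, ?_, ?_⟩
  · have : 0 ≤ ∑ i, (B (e i) + B (-e i)) := Finset.sum_nonneg fun i _ => add_nonneg (hB0 _) (hB0 _)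
    linarith
  intro t ht y
  have hgt := hg t ht.1
  have h1 : y = ∑ i, y i • e i := by
    ext j
    simp [e, Pi.single_apply]
  have h2 : homExt (u t) y ≤ ∑ i, homExt (u t) (y i • e i) := by
    conv_lhs => rw [h1]
    exact Finset.le_sum_of_subadditive _ (homExt_zero.le) (homExt_subadd hgt) _ _
  have h3 : ∀ i, homExt (u t) (y i • e i) ≤ (B (e i) + B (-e i)) * ‖y‖ := by
    intro i
    have hyi : |y i| ≤ ‖y‖ := by
      have := PiLp.norm_apply_le y i
      simpa using this
    have hp := hB0 (e i)
    have hm := hB0 (-e i)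
    rcases le_total 0 (y i) with h | h
    · rw [homExt_smul _ h]
      rw [abs_of_nonneg h] at hyi
      have := hB (e i) t ht
      nlinarith [mul_le_mul hyi this (homExt_nonneg hgt _) (norm_nonneg y), norm_nonneg y, mul_nonneg hm (norm_nonneg y)]
    · have e1 : y i • e i = (- y i) • (- e i) := by simp
      rw [e1, homExt_smul _ (by linarith)]
      rw [abs_of_nonpos h] at hyi
      have := hB (-e i) t ht
      nlinarith [mul_le_mul hyi this (homExt_nonneg hgt _) (norm_nonneg y), norm_nonneg y, mul_nonneg hp (norm_nonneg y)]
  refine h2.trans ((Finset.sum_le_sum fun i _ => h3 i).trans ?_)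
  rw [← Finset.sum_mul]
  nlinarith [norm_nonneg y]

lemma lip_of_bound {v : Eu n → ℝ} (hg : GoodSph v) (M : ℝ) (hM : ∀ y, homExt v y ≤ M * ‖y‖) (x y : Eu n) :
    homExt v x - homExt v y ≤ M * ‖x - y‖ := by
  have h1 := homExt_subadd hg (x - y) y
  rw [sub_add_cancel] at h1
  linarith [hM (x - y)]

lemma joint_cont (hg : ∀ t ∈ Set.Ici (0:ℝ), GoodSph (u t))
    (hc : ∀ x ∈ sph n, ContinuousOn (fun r => u r x) (Set.Ici 0)) (T : ℝ) :
    ContinuousOn (fun p : ℝ × Eu n => homExt (u p.1) p.2) (Set.Icc 0 T ×ˢ Set.univ) := by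
  obtain ⟨M, hM0, hM⟩ := unif_bound hg hc T
  refine continuousOn_prod_of_continuousOn_lipschitzOnWith' _ (⟨M, hM0.le⟩ : NNReal) ?_ ?_
  · intro t ht
    refine LipschitzOnWith.of_dist_le_mul fun x _ y _ => ?_
    rw [Real.dist_eq, dist_eq_norm, abs_le]
    have h1 := lip_of_bound (hg t ht.1) M (hM t ht) x y
    have h2 := lip_of_bound (hg t ht.1) M (hM t ht) y x
    rw [norm_sub_rev] at h2
    constructor
    · change -(M * ‖x - y‖) ≤ homExt (u t) x - homExt (u t) y
      linarith
    · exact h1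
  · intro y _
    exact (homExt_cont hc y).mono Set.Icc_subset_Ici_self

end flow


lemma sigma_lower {n k : ℕ} (hk : 1 ≤ k) (hkn : k ≤ n) {u : Eu n → ℝ} (hg : GoodSph u) {x : Eu n} (hx : ‖x‖ = 1)
    (a : ℝ) (ha : 0 ≤ a) (h : ∀ y, a * ‖y‖ ≤ homExt u y) (hxa : homExt u x = a) :
    a ^ k * (n.choose k : ℝ) ≤ sigmaK n k u x := by
  have hx0 : x ≠ 0 := by rintro rfl; simp at hx
  let T : Eu n →ₗ[ℝ] Eu n := a • (LinearMap.id - (innerₛₗ ℝ x).smulRight x)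
  have hT : ∀ v, T v = a • (v - ⟪x, v⟫ • x) := fun v => by simp [T]
  have hq : ∀ v, ⟪v, T v⟫ = a * (‖v‖ ^ 2 - ⟪x, v⟫ ^ 2) := by
    intro v
    rw [hT, inner_smul_right, inner_sub_right, inner_smul_right, real_inner_self_eq_norm_sq, real_inner_comm x v]
    ring
  rw [← esymm_proj hk hkn x hx a T hT]
  refine esymm_mono hkn T _ ?_ (hess_symm hg.1 hx0) ?_ ?_
  · intro v w
    rw [hT, hT, inner_smul_left, inner_smul_right, inner_sub_left, inner_sub_right, inner_smul_left, inner_smul_right,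
      real_inner_comm x v]
    simp
    ring_nf
    tauto
  · intro v
    rw [hq]
    refine mul_nonneg ha ?_
    have := abs_real_inner_le_norm x v
    rw [hx, one_mul] at this
    nlinarith [sq_abs ⟪x, v⟫, abs_nonneg ⟪x, v⟫]
  · intro v
    rw [hq]
    exact hess_min hg.1 hx a ha h hxa v

lemma sigma_nonneg {n k : ℕ} (hk : 1 ≤ k) (hkn : k ≤ n) {u : Eu n → ℝ} (hg : GoodSph u) {x : Eu n} (hx : ‖x‖ = 1) :
    0 ≤ sigmaK n k u x := by
  have hx0 : x ≠ 0 := by rintro rfl; simp at hx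
  exact esymm_nonneg hk hkn _ (hess_symm hg.1 hx0) (hess_psd1 hg hx)

lemma sigma_cmp {n k : ℕ} (hkn : k ≤ n) {u : Eu n → ℝ} (hg : GoodSph u) {x : Eu n} (hx : ‖x‖ = 1)
    (R : ℝ) (ρ : Eu n ≃ₗᵢ[ℝ] Eu n)
    (h : ∀ v, ⟪v, hessOp u x v⟫ ≤ R * ⟪ρ v, hessOp u (ρ x) (ρ v)⟫) :
    sigmaK n k u x ≤ R ^ k * sigmaK n k u (ρ x) := by
  have hx0 : x ≠ 0 := by rintro rfl; simp at hx
  have hρ0 : ρ x ≠ 0 := by simpa using hx0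
  let T : Eu n →ₗ[ℝ] Eu n := ρ.symm.toLinearEquiv.conj (hessOp u (ρ x)).toLinearMap
  have hT : ∀ v, T v = ρ.symm (hessOp u (ρ x) (ρ v)) := fun v => by simp [T, LinearEquiv.conj_apply]
  have hq : ∀ v w, ⟪v, T w⟫ = ⟪ρ v, hessOp u (ρ x) (ρ w)⟫ := by
    intro v w
    rw [hT, ← ρ.inner_map_map, ρ.apply_symm_apply]
  have e : sigmaK n k u (ρ x) = esymmOp n k T := (esymm_conj _ _).symm
  rw [e, ← esymm_smul hkn]
  refine esymm_mono hkn _ _ (hess_symm hg.1 hx0) ?_ (hess_psd1 hg hx) ?_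
  · intro v w
    rw [LinearMap.smul_apply, LinearMap.smul_apply, inner_smul_left, inner_smul_right, hq, ← real_inner_comm, hq]
    have := hess_symm hg.1 hρ0 (ρ v) (ρ w)
    simp only [ContinuousLinearMap.coe_coe] at this
    rw [← this, real_inner_comm (ρ w)]
    simp
  · intro v
    rw [LinearMap.smul_apply, inner_smul_right, hq]
    exact h v

section flow2
variable {n k : ℕ} {α β : ℝ} {u : ℝ → Eu n → ℝ}

lemma flow_cont (hu : IsoNormFlow n k α β (Set.Ici 0) u) :
    ∀ x ∈ sph n, ContinuousOn (fun r => u r x) (Set.Ici 0) :=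
  fun x hx t ht => (hu.2 x hx t ht).continuousWithinAt

lemma flow_deriv (hu : IsoNormFlow n k α β (Set.Ici 0) u) {x : Eu n} (hx : ‖x‖ = 1) {t : ℝ} (ht : 0 < t) :
    HasDerivAt (fun r => u r x)
      (u t x ^ α * sigmaK n k (u t) x ^ β - (n.choose k : ℝ) ^ β * u t x) t :=
  (hu.2 x (sph_iff.2 hx) t ht.le).hasDerivAt (Ici_mem_nhds ht)

lemma homExt_ge {v : Eu n → ℝ} {a : ℝ} (h : ∀ x, ‖x‖ = 1 → a ≤ v x) (y : Eu n) : a * ‖y‖ ≤ homExt v y := by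
  by_cases hy : y = 0
  · subst hy; simp [homExt_zero]
  · unfold homExt
    rw [mul_comm]
    refine mul_le_mul_of_nonneg_left (h _ ?_) (norm_nonneg _)
    rw [norm_smul, norm_inv, norm_norm, inv_mul_cancel₀ (norm_ne_zero_iff.2 hy)]

lemma sph_compact : IsCompact (sph n) := isCompact_sphere _ _

lemma lower_bound (hk1 : 1 ≤ k) (hkn : k ≤ n) (hβ : 0 < β) (hα : α ≤ 1 - k * β)
    (hu : IsoNormFlow n k α β (Set.Ici 0) u) :
    ∃ c : ℝ, 0 < c ∧ ∀ t, 0 ≤ t → ∀ x, ‖x‖ = 1 → c ≤ u t x := by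
  have hcont := flow_cont hu
  have hpos : ∀ t, 0 ≤ t → ∀ x, ‖x‖ = 1 → 0 < u t x := fun t ht x hx => (hu.1 t ht).2.1 x (sph_iff.2 hx)
  let e0 : Eu n := EuclideanSpace.single 0 1
  have he0 : ‖e0‖ = 1 := by simp [e0]
  obtain ⟨z, hz, hzm⟩ := (sph_compact (n := n)).exists_isMinOn ⟨e0, sph_iff.2 he0⟩
    (f := homExt (u 0)) (fun x hx => (cdAt (hu.1 0 (Set.mem_Ici.2 le_rfl)).1 (by
      rintro rfl; rw [sph_iff] at hx; simp at hx)).continuousAt.continuousWithinAt)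
  have hz1 := sph_iff.1 hz
  have hz2 : ∀ x, ‖x‖ = 1 → u 0 z ≤ u 0 x := by
    intro x hx
    have := hzm (sph_iff.2 hx)
    simp only [Set.mem_setOf_eq] at this
    rwa [homExt_sph _ hx, homExt_sph _ hz1] at this
  have hz0 := hpos 0 le_rfl z hz1
  refine ⟨min 1 (u 0 z), lt_min one_pos hz0, ?_⟩
  by_contra! hcon
  obtain ⟨t1, ht1, x1, hx1, hlt⟩ := hcon
  set m := min 1 (u 0 z) with hm
  obtain ⟨ε, hε, hε2⟩ : ∃ ε : ℝ, 0 < ε ∧ u t1 x1 + ε * t1 < m := by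
    refine ⟨(m - u t1 x1) / (2 * (t1 + 1)), by apply div_pos <;> linarith, ?_⟩
    have : (m - u t1 x1) / (2 * (t1 + 1)) * t1 ≤ (m - u t1 x1) / 2 := by
      rw [div_mul_eq_mul_div, div_le_div_iff₀ (by linarith) (by norm_num)]
      nlinarith
    linarith
  have hF : ContinuousOn (fun p : ℝ × Eu n => homExt (u p.1) p.2 + ε * p.1) (Set.Icc 0 t1 ×ˢ sph n) :=
    ((joint_cont hu.1 hcont t1).mono (Set.prod_mono_right (Set.subset_univ _))).add
      (by fun_prop)
  obtain ⟨⟨t0, x0⟩, ⟨ht0, hx0⟩, hmin⟩ := (isCompact_Icc.prod sph_compact).exists_isMinOn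
    ⟨(t1, x1), ⟨⟨ht1, le_rfl⟩, sph_iff.2 hx1⟩⟩ hF
  simp only at ht0 hx0
  have hx0' := sph_iff.1 hx0
  have hmin2 : ∀ t ∈ Set.Icc 0 t1, ∀ x, ‖x‖ = 1 → u t0 x0 + ε * t0 ≤ u t x + ε * t := by
    intro t ht x hx
    have := hmin (show (t, x) ∈ Set.Icc 0 t1 ×ˢ sph n from ⟨ht, sph_iff.2 hx⟩)
    simp only [Set.mem_setOf_eq] at this
    rwa [homExt_sph _ hx, homExt_sph _ hx0'] at this
  have hb := hmin2 t1 ⟨ht1, le_rfl⟩ x1 hx1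
  have ha0 := hpos t0 ht0.1 x0 hx0'
  have hlt2 : u t0 x0 + ε * t0 < m := by linarith
  have ht0p : 0 < t0 := by
    rcases ht0.1.eq_or_lt with h | h
    · exfalso
      rw [← h] at hlt2
      have := hz2 x0 hx0'
      have h3 : m ≤ u 0 z := min_le_right _ _
      linarith
    · exact h
  have ha1 : u t0 x0 ≤ 1 := by
    have h3 : m ≤ 1 := min_le_left _ _
    nlinarith
  set a := u t0 x0 with ha
  have hmina : ∀ x, ‖x‖ = 1 → a ≤ u t0 x := fun x hx => by linarith [hmin2 t0 ht0 x hx]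
  have hσ := sigma_lower hk1 hkn (hu.1 t0 ht0.1) hx0' a ha0.le (homExt_ge hmina) (homExt_sph _ hx0')
  have hd := flow_deriv hu hx0' ht0p
  have hd2 := left_deriv_nonneg _ _ t0 ((hd.add ((hasDerivAt_id t0).const_mul ε)).neg) ht0p (by
    intro t ht
    have := hmin2 t ⟨ht.1, ht.2.trans ht0.2⟩ x0 hx0'
    simp only [Pi.neg_apply, Pi.add_apply, id]
    linarith)
  rw [← ha] at hd2
  have hch : (0:ℝ) ≤ n.choose k := by positivity
  have h1 : (a ^ k * (n.choose k : ℝ)) ^ β ≤ sigmaK n k (u t0) x0 ^ β :=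
    Real.rpow_le_rpow (by positivity) hσ hβ.le
  have h2 : a ^ α * (a ^ k * (n.choose k : ℝ)) ^ β = a ^ (α + k * β) * (n.choose k : ℝ) ^ β := by
    rw [Real.mul_rpow (by positivity) hch, ← Real.rpow_natCast a k, ← Real.rpow_mul ha0.le, Real.rpow_add ha0]
    ring
  have h3 : a ≤ a ^ (α + k * β) := by
    conv_lhs => rw [← Real.rpow_one a]
    exact Real.rpow_le_rpow_of_exponent_ge ha0 ha1 (by linarith)
  have h4 := mul_le_mul_of_nonneg_left h1 (Real.rpow_nonneg ha0.le α)
  rw [h2] at h4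
  have h5 := mul_le_mul_of_nonneg_right h3 (Real.rpow_nonneg hch β)
  linarith

end flow2


section flow3
variable {n k : ℕ} {α β : ℝ} {u : ℝ → Eu n → ℝ}

lemma power_cmp {α β : ℝ} {k : ℕ} {R w d s s' : ℝ} (hβ : 0 < β) (hα0 : α ≤ 0) (hα : α ≤ 1 - k * β) (hR : 1 ≤ R)
    (hw : 0 < w) (hd : 0 ≤ d) (hs : 0 ≤ s) (hs0 : 0 ≤ s') (h : s ≤ R ^ k * s') :
    (R * (w + d)) ^ α * s ^ β ≤ R * (w ^ α * s' ^ β) := by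
  have hR0 : 0 < R := by linarith
  have h1 : (R * (w + d)) ^ α ≤ (R * w) ^ α :=
    Real.rpow_le_rpow_of_nonpos (by positivity) (by nlinarith) hα0
  have h2 : s ^ β ≤ (R ^ k * s') ^ β := Real.rpow_le_rpow hs h hβ.le
  have h3 : (R * w) ^ α * (R ^ k * s') ^ β = R ^ (α + k * β) * (w ^ α * s' ^ β) := by
    rw [Real.mul_rpow hR0.le hw.le, Real.mul_rpow (by positivity) hs0, ← Real.rpow_natCast R k,
      ← Real.rpow_mul hR0.le, Real.rpow_add hR0]
    ring
  have h4 : R ^ (α + k * β) ≤ R := by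
    conv_rhs => rw [← Real.rpow_one R]
    exact Real.rpow_le_rpow_of_exponent_le hR (by linarith)
  calc _ ≤ (R * w) ^ α * (R ^ k * s') ^ β :=
        mul_le_mul h1 h2 (Real.rpow_nonneg hs _) (Real.rpow_nonneg (by positivity) _)
    _ = R ^ (α + k * β) * (w ^ α * s' ^ β) := h3
    _ ≤ _ := mul_le_mul_of_nonneg_right h4 (mul_nonneg (Real.rpow_nonneg hw.le _) (Real.rpow_nonneg hs0 _))

lemma refl_formula {ν : Eu n} (hν : ‖ν‖ = 1) :
    ∃ ρ : Eu n ≃ₗᵢ[ℝ] Eu n, ∀ y, ρ y = y - (2 * ⟪y, ν⟫) • ν := by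
  refine ⟨(ℝ ∙ ν)ᗮ.reflection, fun y => ?_⟩
  rw [Submodule.reflection_orthogonal_apply, Submodule.reflection_singleton_apply, hν, real_inner_comm]
  simp [mul_smul, two_smul]

lemma comparison (hk1 : 1 ≤ k) (hkn : k ≤ n) (hβ : 0 < β) (hα0 : α ≤ 0) (hα : α ≤ 1 - k * β)
    (hu : IsoNormFlow n k α β (Set.Ici 0) u) (M : ℝ) (hM0 : 0 < M) (hM : ∀ y, homExt (u 0) y ≤ M * ‖y‖)
    {ν : Eu n} (hν : ‖ν‖ = 1) (ρ : Eu n ≃ₗᵢ[ℝ] Eu n) (hρ : ∀ y, ρ y = y - (2 * ⟪y, ν⟫) • ν)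
    (t : ℝ) (ht : 0 ≤ t) (y : Eu n) (hy : 0 ≤ ⟪y, ν⟫) :
    homExt (u t) y ≤ homExt (u t) (ρ y) + 2 * M * Real.exp (-((n.choose k : ℝ) ^ β) * t) * ⟪y, ν⟫ := by
  set γ := (n.choose k : ℝ) ^ β with hγ
  have hcont := flow_cont hu
  have hpos : ∀ t, 0 ≤ t → ∀ x, ‖x‖ = 1 → 0 < u t x := fun t ht x hx => (hu.1 t ht).2.1 x (sph_iff.2 hx)
  -- reduction to the sphere
  have scale : ∀ (t R c : ℝ), 
      (∀ x, ‖x‖ = 1 → 0 ≤ ⟪x, ν⟫ → homExt (u t) x ≤ R * (homExt (u t) (ρ x) + c * ⟪x, ν⟫)) →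
      ∀ y : Eu n, 0 ≤ ⟪y, ν⟫ → homExt (u t) y ≤ R * (homExt (u t) (ρ y) + c * ⟪y, ν⟫) := by
    intro t R c h y hy
    by_cases hy0 : y = 0
    · subst hy0; simp [homExt_zero]
    have hn : 0 < ‖y‖ := norm_pos_iff.2 hy0
    have e : y = ‖y‖ • (‖y‖⁻¹ • y) := by rw [smul_smul, mul_inv_cancel₀ hn.ne', one_smul]
    have h1 := h (‖y‖⁻¹ • y) (by rw [norm_smul, norm_inv, norm_norm, inv_mul_cancel₀ hn.ne'])
      (by rw [real_inner_smul_left]; positivity)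
    rw [map_smul, homExt_smul _ (by positivity), homExt_smul _ (by positivity), real_inner_smul_left] at h1
    have h2 := mul_le_mul_of_nonneg_left h1 hn.le
    have e1 : ‖y‖ * (‖y‖⁻¹ * homExt (u t) y) = homExt (u t) y := by field_simp
    have e2 : ‖y‖ * (R * (‖y‖⁻¹ * homExt (u t) (ρ y) + c * (‖y‖⁻¹ * ⟪y, ν⟫))) =
        R * (homExt (u t) (ρ y) + c * ⟪y, ν⟫) := by field_simp
    rwa [e1, e2] at h2
  suffices hmain : ∀ t, 0 ≤ t → ∀ x, ‖x‖ = 1 → 0 ≤ ⟪x, ν⟫ →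
      homExt (u t) x ≤ homExt (u t) (ρ x) + 2 * M * Real.exp (-γ * t) * ⟪x, ν⟫ by
    have := scale t 1 (2 * M * Real.exp (-γ * t)) (by
      intro x hx hx2; rw [one_mul]; exact hmain t ht x hx hx2) y hy
    rwa [one_mul] at this
  by_contra! hcon
  obtain ⟨t1, ht1, x1, hx1, hx1ν, hlt⟩ := hcon
  have hρn : ∀ x : Eu n, ‖x‖ = 1 → ‖ρ x‖ = 1 := fun x hx => by rw [ρ.norm_map, hx]
  let D : ℝ × Eu n → ℝ := fun p => homExt (u p.1) (ρ p.2) + 2 * M * Real.exp (-γ * p.1) * ⟪p.2, ν⟫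
  have hDdef : ∀ t x, D (t, x) = homExt (u t) (ρ x) + 2 * M * Real.exp (-γ * t) * ⟪x, ν⟫ := fun t x => rfl
  have hDpos : ∀ t, 0 ≤ t → ∀ x, ‖x‖ = 1 → 0 ≤ ⟪x, ν⟫ → 0 < D (t, x) := by
    intro t ht x hx hxν
    rw [hDdef, homExt_sph _ (hρn x hx)]
    have := hpos t ht (ρ x) (hρn x hx)
    positivity
  have hD1 := hDpos t1 ht1 x1 hx1 hx1ν
  rw [← hDdef] at hlt
  set r1 := homExt (u t1) x1 / D (t1, x1) with hr1
  have hr1' : 1 < r1 := by rw [hr1, one_lt_div hD1]; exact hlt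
  have hlog : 0 < Real.log r1 := Real.log_pos hr1'
  set ε := Real.log r1 / (t1 + 1) with hε
  have hε0 : 0 < ε := by rw [hε]; positivity
  have hε1 : ε * t1 < Real.log r1 := by
    rw [hε, div_mul_eq_mul_div, div_lt_iff₀ (by linarith)]
    nlinarith
  have hcK : IsClosed {x : Eu n | 0 ≤ ⟪x, ν⟫} := isClosed_le continuous_const (by fun_prop)
  set K : Set (Eu n) := sph n ∩ {x : Eu n | 0 ≤ ⟪x, ν⟫} with hK
  have hKc : IsCompact K := sph_compact.inter_right hcK
  have memK : ∀ x, x ∈ K ↔ ‖x‖ = 1 ∧ 0 ≤ ⟪x, ν⟫ := by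
    intro x
    constructor
    · rintro ⟨h1, h2⟩; exact ⟨sph_iff.1 h1, h2⟩
    · rintro ⟨h1, h2⟩; exact ⟨sph_iff.2 h1, h2⟩
  have hjc := joint_cont hu.1 hcont t1
  have hDc : ContinuousOn D (Set.Icc 0 t1 ×ˢ K) := by
    refine ContinuousOn.add ?_ (by fun_prop)
    exact hjc.comp (f := fun p : ℝ × Eu n => (p.1, ρ p.2)) (by fun_prop) (fun p hp => ⟨hp.1, Set.mem_univ _⟩)
  have hFc : ContinuousOn (fun p : ℝ × Eu n => homExt (u p.1) p.2 / D p * Real.exp (-ε * p.1)) (Set.Icc 0 t1 ×ˢ K) := by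
    refine ContinuousOn.mul (ContinuousOn.div (hjc.mono (Set.prod_mono_right (Set.subset_univ _))) hDc ?_) (by fun_prop)
    rintro ⟨t, x⟩ ⟨h1, h2⟩
    obtain ⟨h3, h4⟩ := (memK x).1 h2
    exact (hDpos t h1.1 x h3 h4).ne'
  obtain ⟨⟨t0, x0⟩, ⟨ht0, hx0K⟩, hmax⟩ := (isCompact_Icc.prod hKc).exists_isMaxOn
    ⟨(t1, x1), ⟨⟨ht1, le_rfl⟩, (memK x1).2 ⟨hx1, hx1ν⟩⟩⟩ hFc
  simp only at ht0 hx0K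
  obtain ⟨hx0, hx0ν⟩ := (memK x0).1 hx0K
  set V := homExt (u t0) x0 / D (t0, x0) * Real.exp (-ε * t0) with hV
  have hmax2 : ∀ t ∈ Set.Icc 0 t1, ∀ x, ‖x‖ = 1 → 0 ≤ ⟪x, ν⟫ →
      homExt (u t) x ≤ V * Real.exp (ε * t) * D (t, x) := by
    intro t ht x hx hxν
    have h := hmax (show (t, x) ∈ Set.Icc 0 t1 ×ˢ K from ⟨ht, (memK x).2 ⟨hx, hxν⟩⟩)
    have h' : homExt (u t) x / D (t, x) * Real.exp (-ε * t) ≤ V := h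
    have hDp := hDpos t ht.1 x hx hxν
    rw [div_mul_eq_mul_div, div_le_iff₀ hDp] at h'
    have h2 := mul_le_mul_of_nonneg_right h' (Real.exp_pos (ε * t)).le
    have e : Real.exp (-ε * t) * Real.exp (ε * t) = 1 := by rw [← Real.exp_add]; simp
    calc homExt (u t) x = homExt (u t) x * (Real.exp (-ε * t) * Real.exp (ε * t)) := by rw [e, mul_one]
      _ = homExt (u t) x * Real.exp (-ε * t) * Real.exp (ε * t) := by ring
      _ ≤ _ := h2
      _ = _ := by ring
  have hV1 : 1 < V := by
    have h := hmax (show (t1, x1) ∈ Set.Icc 0 t1 ×ˢ K from ⟨⟨ht1, le_rfl⟩, (memK x1).2 ⟨hx1, hx1ν⟩⟩)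
    have h' : r1 * Real.exp (-ε * t1) ≤ V := h
    refine lt_of_lt_of_le ?_ h'
    rw [← Real.exp_log (show 0 < r1 by linarith), ← Real.exp_add, Real.one_lt_exp_iff]
    linarith
  have hD0 := hDpos t0 ht0.1 x0 hx0 hx0ν
  have heq : homExt (u t0) x0 = V * Real.exp (ε * t0) * D (t0, x0) := by
    have e : Real.exp (-ε * t0) * Real.exp (ε * t0) = 1 := by rw [← Real.exp_add]; simp
    rw [hV, mul_assoc (_ / _), e]
    field_simp
  set R := V * Real.exp (ε * t0) with hR
  have hR1 : 1 < R := by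
    have : 1 ≤ Real.exp (ε * t0) := Real.one_le_exp (mul_nonneg hε0.le ht0.1)
    nlinarith
  have hlt0 : D (t0, x0) < homExt (u t0) x0 := by rw [heq]; nlinarith
  have hnorm : ‖x0 - ρ x0‖ = 2 * ⟪x0, ν⟫ := by
    rw [hρ, sub_sub_cancel, norm_smul, hν, mul_one, Real.norm_eq_abs, abs_of_nonneg (by positivity)]
  have ht0p : 0 < t0 := by
    rcases ht0.1.eq_or_lt with h | h
    · exfalso
      rw [← h, hDdef] at hlt0
      have := lip_of_bound (hu.1 0 (Set.mem_Ici.2 le_rfl)) M hM x0 (ρ x0)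
      rw [hnorm] at this
      simp at hlt0
      linarith
    · exact h
  have hx0p : 0 < ⟪x0, ν⟫ := by
    rcases hx0ν.eq_or_lt with h | h
    · exfalso
      have e : ρ x0 = x0 := by rw [hρ, ← h]; simp
      rw [hDdef, e, ← h] at hlt0
      simp at hlt0
    · exact h
  have hx00 : x0 ≠ 0 := by rintro rfl; simp at hx0
  -- space
  set ψ := 2 * M * Real.exp (-γ * t0) with hψ
  have hsp := scale t0 R ψ (fun x hx hxν => hmax2 t0 ht0 x hx hxν)
  have hH := hess_cmp (hu.1 t0 ht0.1).1 hx00 hx0p R ψ ρ (fun y hy => hsp y hy.le) heq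
  have hσ := sigma_cmp (k := k) hkn (hu.1 t0 ht0.1) hx0 R ρ hH
  -- time
  have hd1 := flow_deriv hu hx0 ht0p
  have hd2 := flow_deriv hu (hρn x0 hx0) ht0p
  have hex : HasDerivAt (fun r : ℝ => 2 * M * Real.exp (-γ * r) * ⟪x0, ν⟫) (2 * M * (Real.exp (-γ * t0) * (-γ * 1)) * ⟪x0, ν⟫) t0 :=
    ((((hasDerivAt_id t0).const_mul (-γ)).exp).const_mul (2 * M)).mul_const _
  have hex2 : HasDerivAt (fun r : ℝ => V * Real.exp (ε * r)) (V * (Real.exp (ε * t0) * (ε * 1))) t0 :=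
    (((hasDerivAt_id t0).const_mul ε).exp).const_mul V
  have hd3 := hd1.sub (hex2.mul (hd2.add hex))
  have hd4 := left_deriv_nonneg _ _ t0 hd3 ht0p (by
    intro t ht
    have h1 := hmax2 t ⟨ht.1, ht.2.trans ht0.2⟩ x0 hx0 hx0ν
    have h2 := heq
    rw [hDdef, homExt_sph _ hx0, homExt_sph _ (hρn x0 hx0)] at h1 h2
    simp only [Pi.sub_apply, Pi.mul_apply, Pi.add_apply]
    linarith)
  rw [hDdef, homExt_sph _ hx0, homExt_sph _ (hρn x0 hx0), ← hψ] at heq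
  have hw := hpos t0 ht0.1 (ρ x0) (hρn x0 hx0)
  have hψ0 : 0 < ψ := by rw [hψ]; positivity
  have hp := power_cmp (d := ψ * ⟪x0, ν⟫) hβ hα0 hα hR1.le hw (by positivity)
    (sigma_nonneg hk1 hkn (hu.1 t0 ht0.1) hx0) (sigma_nonneg hk1 hkn (hu.1 t0 ht0.1) (hρn x0 hx0)) hσ
  rw [← heq] at hp
  simp only [Pi.add_apply] at hd4
  rw [← hψ, ← hR, ← hγ] at hd4
  have e5 : V * (Real.exp (ε * t0) * (ε * 1)) = R * ε := by rw [hR]; ring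
  have e6 : 2 * M * (Real.exp (-γ * t0) * (-γ * 1)) * ⟪x0, ν⟫ = - γ * (ψ * ⟪x0, ν⟫) := by rw [hψ]; ring
  rw [e5, e6] at hd4
  have hpp : 0 < R * ε * (u t0 (ρ x0) + ψ * ⟪x0, ν⟫) := by
    have : 0 < R := by linarith
    positivity
  have e7 : γ * u t0 x0 = γ * (R * (u t0 (ρ x0) + ψ * ⟪x0, ν⟫)) := by rw [← heq]
  nlinarith

end flow3

/-- Lemma 4.1: along the normalised flow `∂_t u = u^α σ_k^β − γu` on `[0,∞)`, the quantity
`max_{S^n} |∇u|/u` decays exponentially: there are `C, C₀ > 0` depending only on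
`α, β, u(·,0)` with `|∇u|/u ≤ C e^{−C₀ t}` for all `t ≥ 0`. -/
theorem stmt16 (n k : ℕ) (hn : 2 ≤ n) (hk1 : 1 ≤ k) (hkn : k ≤ n)
    (α β : ℝ) (hβ : 1 / (k : ℝ) < β) (hα : α ≤ 1 - k * β)
    (u : ℝ → Eu n → ℝ) (hu : IsoNormFlow n k α β (Set.Ici 0) u) :
    ∃ C C₀ : ℝ, 0 < C ∧ 0 < C₀ ∧ ∀ t ∈ Set.Ici (0 : ℝ), ∀ x ∈ sph n,
      ‖sphGrad (u t) x‖ / u t x ≤ C * Real.exp (-C₀ * t) := by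
  have hk0 : (0:ℝ) < k := by exact_mod_cast hk1
  have hβ0 : 0 < β := lt_trans (by positivity) hβ
  have hkβ : 1 < k * β := by
    rw [div_lt_iff₀ hk0] at hβ; linarith
  have hα0 : α ≤ 0 := by linarith
  obtain ⟨c, hc0, hc⟩ := lower_bound hk1 hkn hβ0 hα hu
  obtain ⟨M, hM0, hM⟩ := unif_bound hu.1 (flow_cont hu) 0
  have hch : (0:ℝ) < n.choose k := by exact_mod_cast Nat.choose_pos hkn
  refine ⟨M / c, (n.choose k : ℝ) ^ β, by positivity, by positivity, ?_⟩
  intro t ht x hxs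
  have hx := sph_iff.1 hxs
  have ht : 0 ≤ t := ht
  have hg := hu.1 t ht
  have hx0 : x ≠ 0 := by rintro rfl; simp at hx
  set ψ := M * Real.exp (-((n.choose k : ℝ) ^ β) * t) with hψ
  have hψ0 : 0 < ψ := by positivity
  have hcu := hc t ht x hx
  suffices hs : ‖sphGrad (u t) x‖ ≤ ψ by
    rw [div_mul_eq_mul_div]
    exact div_le_div₀ hψ0.le hs hc0 hcu
  set g := sphGrad (u t) x with hgdef
  by_cases hg0 : g = 0
  · rw [hg0]; simpa using hψ0.le
  have hgn : 0 < ‖g‖ := norm_pos_iff.2 hg0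
  have hgx : ⟪x, g⟫ = 0 := by
    have h1 := euler hg.1 hx0
    rw [homExt_sph _ hx] at h1
    rw [hgdef, sphGrad, inner_sub_right, inner_smul_right, real_inner_self_eq_norm_sq, hx, real_inner_comm, h1]
    ring
  set ν := ‖g‖⁻¹ • g with hνdef
  have hν : ‖ν‖ = 1 := by rw [hνdef, norm_smul, norm_inv, norm_norm, inv_mul_cancel₀ hgn.ne']
  have hxν : ⟪x, ν⟫ = 0 := by rw [hνdef, inner_smul_right, hgx, mul_zero]
  have hgν : ⟪gradient (homExt (u t)) x, ν⟫ = ‖g‖ := by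
    have e : gradient (homExt (u t)) x = g + u t x • x := by rw [hgdef, sphGrad]; abel
    rw [e, inner_add_left, real_inner_smul_left, hxν, hνdef, inner_smul_right, real_inner_self_eq_norm_sq]
    field_simp
    ring
  obtain ⟨ρ, hρ⟩ := refl_formula hν
  have hcmp : ∀ s : ℝ, 0 ≤ s → homExt (u t) (x + s • ν) - homExt (u t) (x + s • (-ν)) - 2 * ψ * s ≤ 0 := by
    intro s hs
    have e1 : ⟪x + s • ν, ν⟫ = s := by
      rw [inner_add_left, real_inner_smul_left, hxν, real_inner_self_eq_norm_sq, hν]; ring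
    have h := comparison hk1 hkn hβ0 hα0 hα hu M hM0 (hM 0 ⟨le_rfl, le_rfl⟩) hν ρ hρ t ht (x + s • ν) (by rw [e1]; exact hs)
    have e2 : ρ (x + s • ν) = x + s • (-ν) := by
      rw [hρ, e1]; module
    rw [e1, e2] at h
    rw [hψ]
    linarith
  have hd1 := line_deriv1 hg.1 x ν 0 (by simpa using hx0)
  have hd2 := line_deriv1 hg.1 x (-ν) 0 (by simpa using hx0)
  have hd3 := (hd1.sub hd2).sub ((hasDerivAt_id (0:ℝ)).const_mul (2 * ψ))
  simp only [zero_smul, add_zero, inner_neg_right, hgν] at hd3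
  -- reverse time to use the one-sided derivative test
  have hd4 : HasDerivAt (fun s : ℝ => homExt (u t) (x + (1 - s) • ν) - homExt (u t) (x + (1 - s) • (-ν)) - 2 * ψ * (1 - s))
      (-(‖g‖ - -‖g‖ - 2 * ψ * 1)) 1 := by
    have hl : HasDerivAt (fun s : ℝ => 1 - s) (-1) 1 := by
      simpa using (hasDerivAt_id (1:ℝ)).const_sub 1
    have hd3' : HasDerivAt (fun s : ℝ => homExt (u t) (x + s • ν) - homExt (u t) (x + s • (-ν)) - 2 * ψ * s)
      (‖g‖ - -‖g‖ - 2 * ψ * 1) (1 - 1) := by rw [sub_self]; exact hd3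
    refine (hd3'.comp 1 hl).congr_deriv ?_
    ring
  have := left_deriv_nonneg _ _ 1 hd4 one_pos (by
    intro s hs
    have h := hcmp (1 - s) (by linarith [hs.2])
    simp only [sub_self, zero_smul, add_zero, mul_zero]
    exact h)
  linarith
end
end

section
/- Let n ≥ 2, let k be an integer with 1 ≤ k ≤ n, let β > 0 and α < 1 − kβ, let f : S^n → (0,∞) be smooth, and let c > 0. If u₁ and u₂ are smooth, positive, uniformly convex functions on S^n both satisfying the elliptic equation f u^{α−1} σ_k(W_u)^β = c on S^n, then u₁ = u₂. -/
open MeasureTheory Filter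
open scoped RealInnerProductSpace Topology

noncomputable section

theorem aux_det_rank_one {m : Type*} [Fintype m] [DecidableEq m] {A : Matrix m m ℝ}
    (hA : A.PosSemidef) (v : m → ℝ) : A.det ≤ (A + Matrix.vecMulVec v (star v)).det := by
  by_cases h : A.det = 0
  · rw [h]
    exact (hA.add (Matrix.posSemidef_vecMulVec_self_star v)).det_nonneg
  · have hpd : A.PosDef := hA.posDef_iff_det_ne_zero.mpr h
    have hi : (A⁻¹).PosSemidef := hpd.inv.posSemidef
    rw [Matrix.vecMulVec_eq Unit, Matrix.det_add_replicateCol_mul_replicateRow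
      (isUnit_iff_ne_zero.mpr h)]
    have h1 : (1 : ℝ) ≤ (1 + Matrix.replicateRow Unit (star v) * A⁻¹ *
        Matrix.replicateCol Unit v).det := by
      have h2 := hi.dotProduct_mulVec_nonneg v
      rw [Matrix.det_unique]
      have h3 : (Matrix.replicateRow Unit (star v) * A⁻¹ *
        Matrix.replicateCol Unit v) default default = star v ⬝ᵥ (A⁻¹.mulVec v) := by
        rw [Matrix.mul_assoc, Matrix.mul_apply]
        simp [dotProduct, Matrix.mul_apply, Matrix.mulVec]
      rw [Matrix.add_apply, h3]
      simpa using h2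
    exact le_mul_of_one_le_right hA.det_nonneg h1

theorem aux_det_mono {m : Type*} [Fintype m] [DecidableEq m] {A C : Matrix m m ℝ}
    (hA : A.PosSemidef) (hC : C.PosSemidef) : A.det ≤ (A + C).det := by
  obtain ⟨N, v, rfl⟩ := Matrix.posSemidef_iff_eq_sum_vecMulVec.mp hC
  have key : ∀ s : Finset (Fin N),
      (A + ∑ i ∈ s, Matrix.vecMulVec (v i) (star (v i))).PosSemidef ∧
      A.det ≤ (A + ∑ i ∈ s, Matrix.vecMulVec (v i) (star (v i))).det := by
    intro s
    induction s using Finset.induction_on with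
    | empty => simpa using hA
    | insert a s ha ih =>
      rw [Finset.sum_insert ha, add_comm (Matrix.vecMulVec _ _), ← add_assoc]
      exact ⟨ih.1.add (Matrix.posSemidef_vecMulVec_self_star _),
        ih.2.trans (aux_det_rank_one ih.1 _)⟩
  exact (key Finset.univ).2

theorem aux_esymm_eq {n k : ℕ} (hk : k ≤ n + 1) (T : Eu n →ₗ[ℝ] Eu n) :
    esymmOp n k T = ∑ s ∈ (Finset.univ : Finset (Fin (n+1))).powersetCard k,
      ((T.toMatrix (EuclideanSpace.basisFun (Fin (n+1)) ℝ).toBasis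
        (EuclideanSpace.basisFun (Fin (n+1)) ℝ).toBasis).submatrix
          (Subtype.val : s → Fin (n+1)) (Subtype.val : s → Fin (n+1))).det := by
  have h := Matrix.charpoly_coeff_eq_sum_minors (T.toMatrix
    (EuclideanSpace.basisFun (Fin (n+1)) ℝ).toBasis
    (EuclideanSpace.basisFun (Fin (n+1)) ℝ).toBasis) k (by simpa using hk)
  rw [LinearMap.charpoly_toMatrix, Fintype.card_fin] at h
  rw [esymmOp, h, ← mul_assoc, ← mul_pow]
  simp

theorem aux_esymm_nonneg {n k : ℕ} (hk : k ≤ n + 1) {T : Eu n →ₗ[ℝ] Eu n}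
    (hT : T.IsPositive) : 0 ≤ esymmOp n k T := by
  rw [aux_esymm_eq hk]
  refine Finset.sum_nonneg fun s _ => ?_
  have := (LinearMap.posSemidef_toMatrix_iff (EuclideanSpace.basisFun (Fin (n+1)) ℝ)).mpr hT
  exact (this.submatrix _).det_nonneg

theorem aux_esymm_mono {n k : ℕ} (hk : k ≤ n + 1) {T S : Eu n →ₗ[ℝ] Eu n}
    (hT : T.IsPositive) (hS : (S - T).IsPositive) : esymmOp n k T ≤ esymmOp n k S := by
  rw [aux_esymm_eq hk, aux_esymm_eq hk]
  refine Finset.sum_le_sum fun s _ => ?_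
  have h1 := (LinearMap.posSemidef_toMatrix_iff (EuclideanSpace.basisFun (Fin (n+1)) ℝ)).mpr hT
  have h2 := (LinearMap.posSemidef_toMatrix_iff (EuclideanSpace.basisFun (Fin (n+1)) ℝ)).mpr hS
  have h3 := aux_det_mono (h1.submatrix (Subtype.val : s → Fin (n+1)))
    (h2.submatrix (Subtype.val : s → Fin (n+1)))
  have h4 : ∀ A B : Matrix (Fin (n+1)) (Fin (n+1)) ℝ,
      A.submatrix (Subtype.val : s → Fin (n+1)) (Subtype.val : s → Fin (n+1)) +
      B.submatrix (Subtype.val : s → Fin (n+1)) (Subtype.val : s → Fin (n+1)) =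
      (A + B).submatrix Subtype.val Subtype.val := fun A B => rfl
  rw [h4, ← map_add, add_sub_cancel] at h3
  exact h3

theorem aux_esymm_smul {n k : ℕ} (hk : k ≤ n + 1) (T : Eu n →ₗ[ℝ] Eu n) (m : ℝ) :
    esymmOp n k (m • T) = m ^ k * esymmOp n k T := by
  rw [aux_esymm_eq hk, aux_esymm_eq hk, Finset.mul_sum]
  refine Finset.sum_congr rfl fun s hs => ?_
  rw [map_smul, Matrix.submatrix_smul]
  simp only [Pi.smul_apply]
  rw [Matrix.det_smul, Fintype.card_coe, (Finset.mem_powersetCard.mp hs).2]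

theorem aux_inner_hess {n : ℕ} {g : Eu n → ℝ} {x : Eu n} (hg : ContDiffAt ℝ 2 g x)
    (v w : Eu n) : ⟪fderiv ℝ (gradient g) x v, w⟫ = fderiv ℝ (fderiv ℝ g) x v w := by
  have hd : DifferentiableAt ℝ (fderiv ℝ g) x :=
    (hg.fderiv_right (m := 1) (by norm_num)).differentiableAt (by norm_num)
  let L : (Eu n →L[ℝ] ℝ) →ₗ[ℝ] Eu n :=
    { toFun := fun φ => (InnerProductSpace.toDual ℝ (Eu n)).symm φ
      map_add' := fun a b => map_add _ a b
      map_smul' := fun r a => by simp }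
  have h1 : HasFDerivAt (gradient g)
      ((LinearMap.toContinuousLinearMap L).comp (fderiv ℝ (fderiv ℝ g) x)) x :=
    (LinearMap.toContinuousLinearMap L).hasFDerivAt.comp x hd.hasFDerivAt
  rw [h1.fderiv]
  exact InnerProductSpace.toDual_symm_apply

theorem aux_localMin {n : ℕ} {g : Eu n → ℝ} {x : Eu n} (hg : ContDiffAt ℝ 2 g x)
    (hm : IsLocalMin g x) (v : Eu n) : 0 ≤ fderiv ℝ (fderiv ℝ g) x v v := by
  by_contra! hneg
  have hd : DifferentiableAt ℝ (fderiv ℝ g) x :=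
    (hg.fderiv_right (m := 1) (by norm_num)).differentiableAt (by norm_num)
  have hev : ∀ᶠ y in 𝓝 x, DifferentiableAt ℝ g y := by
    filter_upwards [hg.eventually (by simp)] with y hy
    exact hy.differentiableAt (by norm_num)
  have hline : ∀ t : ℝ, HasDerivAt (fun t : ℝ => x + t • v) v t := fun t => by
    simpa using ((hasDerivAt_id t).smul_const v).const_add x
  have hx0 : x + (0:ℝ) • v = x := by simp
  have hcont : Tendsto (fun t : ℝ => x + t • v) (𝓝 0) (𝓝 x) := by
    have := (hline 0).continuousAt
    rw [ContinuousAt, hx0] at this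
    exact this
  have hderiv : deriv (fun t : ℝ => g (x + t • v)) =ᶠ[𝓝 0] fun t => fderiv ℝ g (x + t • v) v := by
    filter_upwards [hcont.eventually hev] with t ht
    exact (ht.hasFDerivAt.comp_hasDerivAt t (hline t)).deriv
  have hdd : deriv (deriv (fun t : ℝ => g (x + t • v))) 0 = fderiv ℝ (fderiv ℝ g) x v v := by
    rw [hderiv.deriv_eq]
    have h1 : HasDerivAt (fun t : ℝ => fderiv ℝ g (x + t • v)) (fderiv ℝ (fderiv ℝ g) x v) 0 := by
      have h0 : HasFDerivAt (fderiv ℝ g) (fderiv ℝ (fderiv ℝ g) x) (x + (0:ℝ) • v) := by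
        rw [hx0]; exact hd.hasFDerivAt
      exact h0.comp_hasDerivAt (0:ℝ) (hline 0)
    have h2 := h1.clm_apply (hasDerivAt_const (0:ℝ) v)
    simpa using h2.deriv
  have hlm : IsLocalMin (fun t : ℝ => g (x + t • v)) 0 := by
    have := hcont.eventually hm
    filter_upwards [this] with t ht
    simpa using ht
  have hc : ContinuousAt (fun t : ℝ => g (x + t • v)) 0 := by
    have h0 : ContinuousAt g (x + (0:ℝ) • v) := by rw [hx0]; exact hg.continuousAt
    exact ContinuousAt.comp (f := fun t : ℝ => x + t • v) h0 (hline 0).continuousAt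
  have hlM := isLocalMax_of_deriv_deriv_neg (by rw [hdd]; exact hneg) hlm.deriv_eq_zero hc
  have hconst : (fun t : ℝ => g (x + t • v)) =ᶠ[𝓝 0] fun _ => g (x + (0:ℝ) • v) := by
    filter_upwards [hlm, hlM] with t h1 h2
    exact le_antisymm h2 h1
  have : deriv (deriv (fun t : ℝ => g (x + t • v))) 0 = 0 := by
    rw [hconst.deriv.deriv_eq]; simp
  linarith [hdd]

theorem aux_hom {n : ℕ} (u : Eu n → ℝ) {t : ℝ} (ht : 0 < t) (y : Eu n) :
    homExt u (t • y) = t * homExt u y := by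
  unfold homExt
  rw [norm_smul, Real.norm_eq_abs, abs_of_pos ht, smul_smul, mul_assoc]
  congr 3
  field_simp

theorem aux_sph {n : ℕ} (u : Eu n → ℝ) {x : Eu n} (hx : x ∈ sph n) : homExt u x = u x := by
  have : ‖x‖ = 1 := by simpa [sph] using hx
  simp [homExt, this]

theorem aux_ne {n : ℕ} {x : Eu n} (hx : x ∈ sph n) : x ≠ 0 := by
  have : ‖x‖ = 1 := by simpa [sph] using hx
  rintro rfl
  simp at this

theorem aux_contDiffAt {n : ℕ} {u : Eu n → ℝ} (hu : SmoothOnSphere u) {x : Eu n}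
    (hx : x ≠ 0) : ContDiffAt ℝ 2 (homExt u) x :=
  (hu.contDiffAt (isOpen_compl_singleton.mem_nhds hx)).of_le (by
    have h : ((2 : ℕ∞) : WithTop ℕ∞) ≤ ((⊤ : ℕ∞) : WithTop ℕ∞) := WithTop.coe_le_coe.mpr le_top
    exact h)

theorem aux_radial {n : ℕ} {u : Eu n → ℝ} (hu : SmoothOnSphere u) {x : Eu n}
    (hx : x ≠ 0) : fderiv ℝ (fderiv ℝ (homExt u)) x x = 0 := by
  have hg := aux_contDiffAt hu hx
  have hd : DifferentiableAt ℝ (fderiv ℝ (homExt u)) x :=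
    (hg.fderiv_right (m := 1) (by norm_num)).differentiableAt (by norm_num)
  have hfd : ∀ t : ℝ, 0 < t → fderiv ℝ (homExt u) (t • x) = fderiv ℝ (homExt u) x := by
    intro t ht
    have h1 : fderiv ℝ (fun y => homExt u (t • y)) x = t • fderiv ℝ (homExt u) (t • x) :=
      fderiv_comp_smul (f := homExt u) t
    have h2 : (fun y => homExt u (t • y)) = fun y => t • homExt u y := by
      funext y; exact aux_hom u ht y
    rw [h2, fderiv_fun_const_smul (hg.differentiableAt (by norm_num))] at h1
    exact (smul_right_injective _ ht.ne' h1).symm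
  have hl : HasDerivAt (fun t : ℝ => t • x) x 1 := by
    simpa using (hasDerivAt_id (1:ℝ)).smul_const x
  have h0 : HasFDerivAt (fderiv ℝ (homExt u)) (fderiv ℝ (fderiv ℝ (homExt u)) x) ((1:ℝ) • x) := by
    rw [one_smul]; exact hd.hasFDerivAt
  have h3 := h0.comp_hasDerivAt (1:ℝ) hl
  have h4 : (fderiv ℝ (homExt u) ∘ fun t : ℝ => t • x) =ᶠ[𝓝 1] fun _ => fderiv ℝ (homExt u) x := by
    filter_upwards [lt_mem_nhds (zero_lt_one (α := ℝ))] with t ht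
    exact hfd t ht
  have h5 := h3.congr_of_eventuallyEq h4.symm
  exact h5.unique (hasDerivAt_const _ _)

theorem aux_symm {n : ℕ} {u : Eu n → ℝ} (hu : SmoothOnSphere u) {x : Eu n}
    (hx : x ≠ 0) : (hessOp u x).toLinearMap.IsSymmetric := by
  intro v w
  have hg := aux_contDiffAt hu hx
  change ⟪hessOp u x v, w⟫ = ⟪v, hessOp u x w⟫
  rw [real_inner_comm (hessOp u x w) v]
  unfold hessOp
  rw [aux_inner_hess hg, aux_inner_hess hg]
  exact hg.isSymmSndFDerivAt (by simp) v w

theorem aux_pos {n : ℕ} {u : Eu n → ℝ} (hu : GoodSph u) {x : Eu n}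
    (hx : x ∈ sph n) : (hessOp u x).toLinearMap.IsPositive := by
  have hx0 := aux_ne hx
  have hs := aux_symm hu.1 hx0
  refine ⟨hs, fun v => ?_⟩
  change 0 ≤ ⟪hessOp u x v, v⟫
  have hn : ‖x‖ = 1 := by simpa [sph] using hx
  have hxx : ⟪x, x⟫ = (1:ℝ) := by rw [real_inner_self_eq_norm_sq, hn]; norm_num
  have hrad : hessOp u x x = 0 := by
    refine ext_inner_right ℝ fun w => ?_
    unfold hessOp
    rw [aux_inner_hess (aux_contDiffAt hu.1 hx0), aux_radial hu.1 hx0]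
    simp
  set w := v - ⟪x, v⟫ • x with hw
  have hxw : ⟪x, w⟫ = (0:ℝ) := by
    rw [hw, inner_sub_right, inner_smul_right, hxx]; ring
  have hHv : hessOp u x v = hessOp u x w := by
    rw [hw, map_sub, map_smul, hrad]; simp
  have hvw : v = w + ⟪x, v⟫ • x := by rw [hw]; abel
  have h2 : ⟪hessOp u x w, x⟫ = (0:ℝ) := by
    have := hs w x
    change ⟪hessOp u x w, x⟫ = ⟪w, hessOp u x x⟫ at this
    rw [this, hrad, inner_zero_right]
  have h3 : ⟪hessOp u x v, v⟫ = ⟪w, hessOp u x w⟫ := by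
    rw [hHv]
    conv_lhs => rw [hvw]
    rw [inner_add_right, inner_smul_right, h2, real_inner_comm]; ring
  rw [h3]
  by_cases hw0 : w = 0
  · rw [hw0]; simp
  · exact (hu.2.2 x hx w hxw hw0).le

theorem aux_le (n k : ℕ) (hkn : k ≤ n)
    (α β : ℝ) (hβ : 0 < β) (hα : α < 1 - k * β)
    (f : Eu n → ℝ) (hfp : PosOnSphere f)
    (c : ℝ) (hc : 0 < c)
    (u₁ u₂ : Eu n → ℝ) (h₁ : GoodSph u₁) (h₂ : GoodSph u₂)
    (he₁ : ∀ x ∈ sph n, f x * u₁ x ^ (α - 1) * sigmaK n k u₁ x ^ β = c)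
    (he₂ : ∀ x ∈ sph n, f x * u₂ x ^ (α - 1) * sigmaK n k u₂ x ^ β = c) :
    ∀ x ∈ sph n, u₁ x ≤ u₂ x := by
  intro z hz
  have hk : k ≤ n + 1 := by omega
  have hcpt : IsCompact (sph n) := isCompact_sphere _ _
  have hcont : ∀ u : Eu n → ℝ, SmoothOnSphere u → ContinuousOn u (sph n) := by
    intro u hu
    have h : ContinuousOn (homExt u) (sph n) := hu.continuousOn.mono fun x hx => aux_ne hx
    exact h.congr fun x hx => (aux_sph u hx).symm
  obtain ⟨x, hx, hmax⟩ := hcpt.exists_isMaxOn ⟨z, hz⟩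
    ((hcont u₁ h₁.1).div (hcont u₂ h₂.1) fun y hy => (h₂.2.1 y hy).ne')
  set m := u₁ x / u₂ x with hm
  have hp1 := h₁.2.1 x hx
  have hp2 := h₂.2.1 x hx
  have hmpos : 0 < m := div_pos hp1 hp2
  have hle : ∀ y ∈ sph n, u₁ y ≤ m * u₂ y := fun y hy =>
    (div_le_iff₀ (h₂.2.1 y hy)).mp (hmax hy)
  have hux : u₁ x = m * u₂ x := by rw [hm]; field_simp
  have hx0 := aux_ne hx
  have hg1 := aux_contDiffAt h₁.1 hx0
  have hg2 := aux_contDiffAt h₂.1 hx0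
  have hgle : ∀ y : Eu n, y ≠ 0 → homExt u₁ y ≤ m * homExt u₂ y := by
    intro y hy
    have hny : 0 < ‖y‖ := norm_pos_iff.mpr hy
    have hmem : ‖y‖⁻¹ • y ∈ sph n := by
      simp [sph, norm_smul, hny.ne']
    unfold homExt
    have := mul_le_mul_of_nonneg_left (hle _ hmem) hny.le
    linarith
  have hlm : IsLocalMin (fun y => m * homExt u₂ y - homExt u₁ y) x := by
    filter_upwards [isOpen_compl_singleton.mem_nhds hx0] with y hy
    have h := hgle y hy
    rw [aux_sph u₁ hx, aux_sph u₂ hx, hux]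
    linarith
  have hgg : ContDiffAt ℝ 2 (fun y => m * homExt u₂ y - homExt u₁ y) x :=
    (contDiffAt_const.mul hg2).sub hg1
  have hd1 : DifferentiableAt ℝ (fderiv ℝ (homExt u₁)) x :=
    (hg1.fderiv_right (m := 1) (by norm_num)).differentiableAt (by norm_num)
  have hd2 : DifferentiableAt ℝ (fderiv ℝ (homExt u₂)) x :=
    (hg2.fderiv_right (m := 1) (by norm_num)).differentiableAt (by norm_num)
  have hfe : fderiv ℝ (fun y => m * homExt u₂ y - homExt u₁ y) =ᶠ[𝓝 x]
      fun y => m • fderiv ℝ (homExt u₂) y - fderiv ℝ (homExt u₁) y := by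
    filter_upwards [isOpen_compl_singleton.mem_nhds hx0] with y hy
    have e1 := ((aux_contDiffAt h₁.1 hy).differentiableAt (by norm_num)).hasFDerivAt
    have e2 := ((aux_contDiffAt h₂.1 hy).differentiableAt (by norm_num)).hasFDerivAt
    exact ((e2.const_mul m).sub e1).fderiv
  have hff : fderiv ℝ (fderiv ℝ (fun y => m * homExt u₂ y - homExt u₁ y)) x =
      m • fderiv ℝ (fderiv ℝ (homExt u₂)) x - fderiv ℝ (fderiv ℝ (homExt u₁)) x := by
    rw [hfe.fderiv_eq]
    exact ((hd2.hasFDerivAt.const_smul m).sub hd1.hasFDerivAt).fderiv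
  have P1 := aux_pos h₁ hx
  have P2 := aux_pos h₂ hx
  have P3 : (m • (hessOp u₂ x).toLinearMap - (hessOp u₁ x).toLinearMap).IsPositive := by
    refine ⟨(P2.1.smul (by simp)).sub P1.1, fun v => ?_⟩
    change 0 ≤ ⟪m • hessOp u₂ x v - hessOp u₁ x v, v⟫
    rw [inner_sub_left, real_inner_smul_left]
    unfold hessOp
    rw [aux_inner_hess hg1, aux_inner_hess hg2]
    have := aux_localMin hgg hlm v
    rw [hff] at this
    simpa using this
  have hs1 : 0 ≤ sigmaK n k u₁ x := aux_esymm_nonneg hk P1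
  have hs2 : 0 ≤ sigmaK n k u₂ x := aux_esymm_nonneg hk P2
  have hs : sigmaK n k u₁ x ≤ m ^ k * sigmaK n k u₂ x := by
    unfold sigmaK
    rw [← aux_esymm_smul hk]
    exact aux_esymm_mono hk P1 P3
  have hm1 : m ≤ 1 := by
    by_contra! hgt
    have hf := hfp x hx
    have e1 := he₁ x hx
    have e2 := he₂ x hx
    have b1 : sigmaK n k u₁ x ^ β ≤ m ^ ((k:ℝ) * β) * sigmaK n k u₂ x ^ β := by
      calc _ ≤ (m ^ k * sigmaK n k u₂ x) ^ β := Real.rpow_le_rpow hs1 hs hβ.le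
        _ = _ := by
          rw [Real.mul_rpow (by positivity) hs2, Real.rpow_mul hmpos.le, Real.rpow_natCast]
    have b2 : u₁ x ^ (α - 1) = m ^ (α - 1) * u₂ x ^ (α - 1) := by
      rw [hux, Real.mul_rpow hmpos.le hp2.le]
    have b3 : c ≤ m ^ (α - 1 + k * β) * c := by
      calc c = f x * u₁ x ^ (α - 1) * sigmaK n k u₁ x ^ β := e1.symm
        _ ≤ f x * u₁ x ^ (α - 1) * (m ^ ((k:ℝ) * β) * sigmaK n k u₂ x ^ β) :=
          mul_le_mul_of_nonneg_left b1 (by positivity)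
        _ = m ^ (α - 1 + k * β) * (f x * u₂ x ^ (α - 1) * sigmaK n k u₂ x ^ β) := by
          rw [b2, Real.rpow_add hmpos]; ring
        _ = _ := by rw [e2]
    have b4 : m ^ (α - 1 + k * β) < 1 := Real.rpow_lt_one_of_one_lt_of_neg hgt (by linarith)
    nlinarith
  have := hle z hz
  have hz2 := h₂.2.1 z hz
  nlinarith

/-- Uniqueness of the solution of the elliptic (soliton) equation `f u^{α−1} σ_k^β = c`
when `α < 1 − kβ`. -/
theorem stmt17 (n k : ℕ) (hn : 2 ≤ n) (hk1 : 1 ≤ k) (hkn : k ≤ n)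
    (α β : ℝ) (hβ : 0 < β) (hα : α < 1 - k * β)
    (f : Eu n → ℝ) (hfs : SmoothOnSphere f) (hfp : PosOnSphere f)
    (c : ℝ) (hc : 0 < c)
    (u₁ u₂ : Eu n → ℝ) (h₁ : GoodSph u₁) (h₂ : GoodSph u₂)
    (he₁ : ∀ x ∈ sph n, f x * u₁ x ^ (α - 1) * sigmaK n k u₁ x ^ β = c)
    (he₂ : ∀ x ∈ sph n, f x * u₂ x ^ (α - 1) * sigmaK n k u₂ x ^ β = c) :
    ∀ x ∈ sph n, u₁ x = u₂ x := by
  intro x hx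
  exact le_antisymm
    (aux_le n k hkn α β hβ hα f hfp c hc u₁ u₂ h₁ h₂ he₁ he₂ x hx)
    (aux_le n k hkn α β hβ hα f hfp c hc u₂ u₁ h₂ h₁ he₂ he₁ x hx)
end
end
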